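/- arXiv:2409.00907 — 2 statements merged into one kernel-verified Lean document; each statement's English description precedes it below -/
import Mathlib

section
/- For every nonzero integer d, there exists a triangulated n-sphere with 6|d| + n vertices admitting a simplicial map of degree 3d to S^n_{n+2}. -/
open Finset

/-- An abstract simplicial complex on vertex type `V`: a collection of nonempty
finite sets of vertices closed under taking nonempty subsets. -/
structure AbsCx (V : Type*) where
  faces : Set (Finset V)
  down_closed : ∀ ⦃s t : Finset V⦄, s ∈ faces → t ⊆ s → t.Nonempty → t ∈ faces
  nonempty_of_mem : ∀ ⦃s⦄, s ∈ faces → s.Nonempty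

namespace AbsCx

variable {V W : Type*}

/-- The vertices of a complex. -/
def vertexSet (K : AbsCx V) : Set V := {v | {v} ∈ K.faces}

/-- The `n`-dimensional faces (given by `n+1` vertices). -/
def facetsOfDim (K : AbsCx V) (n : ℕ) : Set (Finset V) :=
  {s | s ∈ K.faces ∧ s.card = n + 1}

/-- A simplicial map sends faces to faces. -/
def IsSimplicialMap [DecidableEq W] (K : AbsCx V) (L : AbsCx W) (f : V → W) : Prop :=
  ∀ s ∈ K.faces, s.image f ∈ L.faces

/-- Geometric realization of an abstract simplicial complex, as a subspace of `V → ℝ`. -/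
def realization (K : AbsCx V) : Set (V → ℝ) :=
  {g | (∀ v, 0 ≤ g v) ∧ ∃ s ∈ K.faces, (∀ v, v ∉ s → g v = 0) ∧ ∑ v ∈ s, g v = 1}

/-- `K` is a triangulation of the `n`-sphere. -/
def IsSphereTriangulation (n : ℕ) (K : AbsCx V) : Prop :=
  Nonempty (K.realization ≃ₜ Metric.sphere (0 : EuclideanSpace ℝ (Fin (n+1))) 1)

/-- `K` is a triangulation of the closed `n`-disc. -/
def IsDiscTriangulation (n : ℕ) (K : AbsCx V) : Prop :=
  Nonempty (K.realization ≃ₜ Metric.closedBall (0 : EuclideanSpace ℝ (Fin n)) 1)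

/-- `K` triangulates a closed (compact, boundaryless = locally Euclidean) topological
`n`-manifold. -/
def IsClosedManifoldTriangulation (n : ℕ) (K : AbsCx V) : Prop :=
  ∃ (M : Type) (ts : TopologicalSpace M),
    @CompactSpace M ts ∧ Nonempty (@ChartedSpace (EuclideanSpace ℝ (Fin n)) _ M ts) ∧
      Nonempty (@Homeomorph (K.realization) M _ ts)

/-- A coherent orientation of the `n`-dimensional faces of `K`: a sign function on
ordered `(n+1)`-tuples of vertices, alternating under permutations, equal to `±1`
exactly on the orderings of `n`-faces, and such that two facets sharing an
`(n-1)`-face (i.e. orderings differing in exactly one coordinate) get opposite signs. -/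
structure CoherentOrientation [DecidableEq V] (n : ℕ) (K : AbsCx V) where
  sign : (Fin (n+1) → V) → ℤ
  sign_perm : ∀ (x : Fin (n+1) → V) (σ : Equiv.Perm (Fin (n+1))),
    sign (x ∘ σ) = (Equiv.Perm.sign σ : ℤ) * sign x
  sign_unit : ∀ x : Fin (n+1) → V, Function.Injective x →
    Finset.image x Finset.univ ∈ K.faces → sign x = 1 ∨ sign x = -1
  sign_zero : ∀ x : Fin (n+1) → V,
    ¬ Function.Injective x ∨ Finset.image x Finset.univ ∉ K.faces → sign x = 0
  coherent : ∀ x y : Fin (n+1) → V,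
    (∃ i, x i ≠ y i ∧ ∀ j, j ≠ i → x j = y j) →
    sign x ≠ 0 → sign y ≠ 0 → sign y = - sign x

open scoped Classical in
/-- The algebraic number of preimages of the ordered simplex `y` under `f`. -/
noncomputable def algSum [Fintype V] {n : ℕ}
    (sgn : (Fin (n+1) → V) → ℤ) (f : V → W) (y : Fin (n+1) → W) : ℤ :=
  ∑ x : Fin (n+1) → V, if f ∘ x = y then sgn x else 0

/-- `f` has degree `d`: the algebraic number of preimages of every positively
oriented facet of the target equals `d`. -/
def HasDegree [Fintype V] [DecidableEq V] [DecidableEq W] {n : ℕ}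
    {K : AbsCx V} {L : AbsCx W}
    (oK : CoherentOrientation n K) (oL : CoherentOrientation n L)
    (f : V → W) (d : ℤ) : Prop :=
  ∀ y : Fin (n+1) → W, oL.sign y = 1 → algSum oK.sign f y = d

/-- The standard `n`-sphere `S^n_{n+2}`: the boundary complex of the `(n+1)`-simplex,
i.e. all proper nonempty subsets of `n+2` vertices. -/
def stdSphere (n : ℕ) : AbsCx (Fin (n+2)) where
  faces := {s | s.Nonempty ∧ s ≠ Finset.univ}
  down_closed := fun {s t} hs hts ht =>
    ⟨ht, fun h => hs.2 (Finset.univ_subset_iff.mp (h ▸ hts))⟩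
  nonempty_of_mem := fun {s} hs => hs.1

/-- Boundary edges of a 2-dimensional complex: edges lying in exactly one triangle. -/
def boundaryEdges (K : AbsCx V) : Set (Finset V) :=
  {e | e ∈ K.faces ∧ e.card = 2 ∧ Set.ncard {s | s ∈ K.faces ∧ s.card = 3 ∧ e ⊆ s} = 1}

end AbsCx

open AbsCx



namespace Stmt8

/-- nonnegative coefficient vectors supported on a face -/
def IsC {V : Type} (K : AbsCx V) (c : V → ℝ) : Prop :=
  (∀ v, 0 ≤ c v) ∧ ∃ s ∈ K.faces, ∀ v, v ∉ s → c v = 0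

/-- `p` realizes `K` as a complete simplicial fan. -/
structure IsFan {V : Type} [Fintype V] {n : ℕ} (K : AbsCx V) (p : V → Fin n → ℝ) : Prop where
  ex : ∀ x : Fin n → ℝ, ∃ c, IsC K c ∧ ∑ v, c v • p v = x
  uniq : ∀ c c' : V → ℝ, IsC K c → IsC K c' → ∑ v, c v • p v = ∑ v, c' v • p v → c = c'

section
variable {V : Type} [Fintype V] [DecidableEq V]

lemma IsFan.indep {n : ℕ} {K : AbsCx V} {p : V → Fin n → ℝ} (h : IsFan K p)
    {s : Finset V} (hs : s ∈ K.faces) (a : V → ℝ) (ha : ∀ v, v ∉ s → a v = 0)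
    (h0 : ∑ v, a v • p v = 0) : a = 0 := by
  have h1 := h.uniq (fun v => max (a v) 0) (fun v => max (-a v) 0)
    ⟨fun v => le_max_right _ _, s, hs, fun v hv => by simp [ha v hv]⟩
    ⟨fun v => le_max_right _ _, s, hs, fun v hv => by simp [ha v hv]⟩ (by
      rw [← sub_eq_zero, ← Finset.sum_sub_distrib, ← h0]
      refine Finset.sum_congr rfl fun v _ => ?_
      rw [← sub_smul]
      congr 1
      rcases le_total (a v) 0 with h | h
      · rw [max_eq_right h, max_eq_left (by linarith)]; ring
      · rw [max_eq_left h, max_eq_right (by linarith)]; ring)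
  funext v
  have := congrFun h1 v
  beta_reduce at this
  rcases le_total (a v) 0 with h | h
  · rw [max_eq_right h, max_eq_left (by linarith)] at this; simp; linarith
  · rw [max_eq_left h, max_eq_right (by linarith)] at this; simp; linarith

lemma isCompact_realization (K : AbsCx V) : IsCompact K.realization := by
  have hsub : K.realization = ⋃ s ∈ {s : Finset V | s ∈ K.faces},
      {g : V → ℝ | (∀ v, 0 ≤ g v) ∧ (∀ v, v ∉ s → g v = 0) ∧ ∑ v ∈ s, g v = 1} := by
    ext g
    simp only [realization, Set.mem_ofPred_eq, Set.mem_iUnion]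
    constructor
    · rintro ⟨h, s, hs, h1, h2⟩; exact ⟨s, hs, h, h1, h2⟩
    · rintro ⟨s, hs, h, h1, h2⟩; exact ⟨h, s, hs, h1, h2⟩
  rw [hsub]
  refine (Set.toFinite _).isCompact_biUnion fun s _ => ?_
  refine IsCompact.of_isClosed_subset (isCompact_Icc (a := (0 : V → ℝ)) (b := 1)) ?_ ?_
  · have e : {g : V → ℝ | (∀ v, 0 ≤ g v) ∧ (∀ v, v ∉ s → g v = 0) ∧ ∑ v ∈ s, g v = 1} =
        (⋂ v, {g : V → ℝ | 0 ≤ g v}) ∩ ((⋂ v, ⋂ (_ : v ∉ s), {g : V → ℝ | g v = 0}) ∩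
          {g | ∑ v ∈ s, g v = 1}) := by
      ext g; simp
    rw [e]
    refine IsClosed.inter (isClosed_iInter fun v => isClosed_le (by fun_prop) (by fun_prop))
      (IsClosed.inter (isClosed_iInter fun v => isClosed_iInter fun _ =>
        isClosed_eq (by fun_prop) (by fun_prop)) (isClosed_eq (by fun_prop) (by fun_prop)))
  · rintro g ⟨h0, h1, h2⟩
    refine ⟨fun v => h0 v, fun v => ?_⟩
    by_cases hv : v ∈ s
    · show g v ≤ 1
      rw [← h2] ; exact Finset.single_le_sum (fun i _ => h0 i) hv
    · rw [h1 v hv]; exact zero_le_one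

lemma IsFan.sphere {n : ℕ} {K : AbsCx V} {p : V → Fin (n+1) → ℝ} (h : IsFan K p) :
    K.IsSphereTriangulation n := by
  have : CompactSpace K.realization := isCompact_iff_compactSpace.mp (isCompact_realization K)
  have hsum : ∀ g : K.realization, ∑ v, g.1 v = 1 := by
    rintro ⟨g, h0, s, hs, h1, h2⟩
    exact (Finset.sum_subset (Finset.subset_univ s) (fun v _ hv => h1 v hv)).symm.trans h2
  have hC : ∀ g : K.realization, IsC K g.1 := by
    rintro ⟨g, h0, s, hs, h1, h2⟩
    exact ⟨h0, s, hs, h1⟩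
  have hsmul : ∀ (g : V → ℝ) (a : ℝ), 0 ≤ a → IsC K g → IsC K (fun v => a * g v) := by
    rintro g a ha ⟨h0, s, hs, h1⟩
    exact ⟨fun v => mul_nonneg ha (h0 v), s, hs, fun v hv => by simp [h1 v hv]⟩
  let L : (V → ℝ) → EuclideanSpace ℝ (Fin (n+1)) := fun g => WithLp.toLp 2 (∑ v, g v • p v)
  have hLs : ∀ (g : V → ℝ) (a : ℝ), L (fun v => a * g v) = a • L g := by
    intro g a
    simp only [L, ← WithLp.toLp_smul, Finset.smul_sum, mul_smul]
  have hLc : Continuous L := by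
    refine (PiLp.continuous_toLp 2 _).comp ?_
    fun_prop
  have hLinj : ∀ g g', IsC K g → IsC K g' → L g = L g' → g = g' := by
    intro g g' hg hg' e
    exact h.uniq g g' hg hg' ((WithLp.toLp_injective 2) e)
  have hL0 : ∀ g : K.realization, L g.1 ≠ 0 := by
    intro g e
    have : (fun v => (0:ℝ) * g.1 v) = g.1 := hLinj _ _ (hsmul _ 0 le_rfl (hC g)) (hC g) (by
      rw [hLs, e, zero_smul])
    have h1 := hsum g
    rw [← this] at h1
    simp at h1
  let F : K.realization → Metric.sphere (0 : EuclideanSpace ℝ (Fin (n+1))) 1 := fun g =>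
    ⟨‖L g.1‖⁻¹ • L g.1, by
      rw [mem_sphere_zero_iff_norm, norm_smul, norm_inv, norm_norm,
        inv_mul_cancel₀ (norm_ne_zero_iff.mpr (hL0 g))]⟩
  have hFc : Continuous F := by
    refine Continuous.subtype_mk ?_ _
    have : Continuous fun g : K.realization => L g.1 := hLc.comp continuous_subtype_val
    exact (this.norm.inv₀ fun g => norm_ne_zero_iff.mpr (hL0 g)).smul this
  have hFinj : Function.Injective F := by
    intro g g' e
    have e1 : ‖L g.1‖⁻¹ • L g.1 = ‖L g'.1‖⁻¹ • L g'.1 := congrArg Subtype.val e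
    rw [← hLs, ← hLs] at e1
    have e2 := hLinj _ _ (hsmul _ _ (by positivity) (hC g)) (hsmul _ _ (by positivity) (hC g')) e1
    have e3 : ‖L g.1‖⁻¹ = ‖L g'.1‖⁻¹ := by
      have := congrArg (fun q : V → ℝ => ∑ v, q v) e2
      simp only [← Finset.mul_sum, hsum, mul_one] at this
      exact this
    rw [← e3] at e2
    have hp : ‖L g.1‖⁻¹ ≠ 0 := inv_ne_zero (norm_ne_zero_iff.mpr (hL0 g))
    apply Subtype.ext
    funext v
    exact mul_left_cancel₀ hp (congrFun e2 v)
  have hFsurj : Function.Surjective F := by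
    rintro ⟨x, hx⟩
    rw [mem_sphere_zero_iff_norm] at hx
    obtain ⟨c, hc, hcx⟩ := h.ex (WithLp.ofLp x)
    have hLcx : L c = x := by simp only [L, hcx]
    have hT0 : 0 ≤ ∑ v, c v := Finset.sum_nonneg fun v _ => hc.1 v
    have hT : 0 < ∑ v, c v := by
      rcases hT0.lt_or_eq with h | h
      · exact h
      · exfalso
        have : ∀ v, c v = 0 := fun v =>
          (Finset.sum_eq_zero_iff_of_nonneg (fun v _ => hc.1 v)).mp h.symm v (Finset.mem_univ v)
        have hc0 : c = fun v => (0:ℝ) * c v := by funext v; simp [this v]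
        rw [hc0, hLs, zero_smul] at hLcx
        rw [← hLcx] at hx
        simp at hx
    set T := ∑ v, c v with hTdef
    have hg := hsmul c T⁻¹ (by positivity) hc
    obtain ⟨h0, s, hs, h1⟩ := hg
    have hgs : ∑ v ∈ s, T⁻¹ * c v = 1 := by
      rw [Finset.sum_subset (Finset.subset_univ s) (fun v _ hv => h1 v hv), ← Finset.mul_sum,
        ← hTdef, inv_mul_cancel₀ hT.ne']
    refine ⟨⟨fun v => T⁻¹ * c v, h0, s, hs, h1, hgs⟩, ?_⟩
    apply Subtype.ext
    simp only [F]
    rw [hLs, hLcx, norm_smul, hx, smul_smul]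
    simp [abs_of_pos hT, hT.ne']
  exact ⟨Continuous.homeoOfEquivCompactToT2 (f := Equiv.ofBijective F ⟨hFinj, hFsurj⟩) hFc⟩

end

end Stmt8

namespace Stmt8

section
variable {V : Type} [Fintype V] [DecidableEq V]

/-- push a weight on indices to a weight on vertices -/
def push {m : ℕ} (x : Fin m → V) (w : Fin m → ℝ) (v : V) : ℝ := ∑ i, if x i = v then w i else 0

lemma sum_push {m n : ℕ} (x : Fin m → V) (w : Fin m → ℝ) (p : V → Fin n → ℝ) :
    ∑ v, push x w v • p v = ∑ i, w i • p (x i) := by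
  simp only [push, Finset.sum_smul]
  rw [Finset.sum_comm]
  refine Finset.sum_congr rfl fun i _ => ?_
  simp [ite_smul]

lemma push_apply {m : ℕ} {x : Fin m → V} (hx : Function.Injective x) (w : Fin m → ℝ) (i : Fin m) :
    push x w (x i) = w i := by
  simp [push, hx.eq_iff]

lemma push_zero {m : ℕ} {x : Fin m → V} (w : Fin m → ℝ) {v : V}
    (hv : v ∉ Finset.image x Finset.univ) : push x w v = 0 := by
  refine Finset.sum_eq_zero fun i _ => ?_
  rw [if_neg]
  rintro rfl
  exact hv (Finset.mem_image_of_mem _ (Finset.mem_univ _))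

lemma push_isC {m : ℕ} {K : AbsCx V} {x : Fin m → V} {w : Fin m → ℝ} (hw : ∀ i, 0 ≤ w i)
    {s : Finset V} (hs : s ∈ K.faces) (hx : Finset.image x Finset.univ ⊆ s) : IsC K (push x w) := by
  refine ⟨fun v => Finset.sum_nonneg fun i _ => ?_, s, hs, fun v hv => push_zero _ fun h => hv (hx h)⟩
  split_ifs
  · exact hw i
  · exact le_rfl

/-- determinant of the fan vectors of an ordered simplex -/
noncomputable def dt {n : ℕ} (p : V → Fin (n+1) → ℝ) (x : Fin (n+1) → V) : ℝ :=
  Matrix.det (Matrix.of fun i => p (x i))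

open scoped Classical in
/-- orientation sign of an ordered simplex -/
noncomputable def sgn {n : ℕ} (K : AbsCx V) (p : V → Fin (n+1) → ℝ) (x : Fin (n+1) → V) : ℤ :=
  if Finset.image x Finset.univ ∈ K.faces then ((SignType.sign (dt p x) : SignType) : ℤ) else 0

variable {n : ℕ} {K : AbsCx V} {p : V → Fin (n+1) → ℝ}

lemma IsFan.dt_ne (h : IsFan K p) {x : Fin (n+1) → V} (hx : Function.Injective x)
    (hf : Finset.image x Finset.univ ∈ K.faces) : dt p x ≠ 0 := by
  intro h0
  obtain ⟨w, hw, hw0⟩ := Matrix.exists_vecMul_eq_zero_iff.mpr h0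
  apply hw
  have h1 : ∑ v, push x w v • p v = 0 := by
    rw [sum_push, ← hw0]
    ext j
    simp [Matrix.vecMul, dotProduct]
  have := h.indep hf (push x w) (fun v hv => push_zero _ hv) h1
  funext i
  rw [← push_apply hx w i, this]
  rfl

lemma dt_perm (x : Fin (n+1) → V) (σ : Equiv.Perm (Fin (n+1))) :
    dt p (x ∘ σ) = (Equiv.Perm.sign σ : ℤ) * dt p x := by
  exact Matrix.det_permute σ (Matrix.of fun i => p (x i))

lemma dt_inj {x : Fin (n+1) → V} (h : dt p x ≠ 0) : Function.Injective x := by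
  intro i j hij
  by_contra hne
  exact h (Matrix.det_zero_of_row_eq hne (show p (x i) = p (x j) by rw [hij]))

lemma sgn_perm (x : Fin (n+1) → V) (σ : Equiv.Perm (Fin (n+1))) :
    sgn K p (x ∘ σ) = (Equiv.Perm.sign σ : ℤ) * sgn K p x := by
  have : Finset.image (x ∘ σ) Finset.univ = Finset.image x Finset.univ := by
    ext v
    simp only [Finset.mem_image, Finset.mem_univ, true_and, Function.comp]
    exact ⟨fun ⟨a, h⟩ => ⟨σ a, h⟩, fun ⟨a, h⟩ => ⟨σ.symm a, by simpa using h⟩⟩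
  unfold sgn
  rw [this, dt_perm]
  split_ifs
  · rcases Int.units_eq_one_or (Equiv.Perm.sign σ) with h | h <;> simp [h, Left.sign_neg]
  · simp

lemma sgn_ne {x : Fin (n+1) → V} (h : sgn K p x ≠ 0) :
    Function.Injective x ∧ Finset.image x Finset.univ ∈ K.faces := by
  unfold sgn at h
  split_ifs at h with hf
  · refine ⟨dt_inj (p := p) fun h0 => h ?_, hf⟩
    simp [h0]
  · exact absurd rfl h

lemma dt_update (x : Fin (n+1) → V) (i : Fin (n+1)) (v : V) :
    dt p (Function.update x i v) = ((Matrix.of fun i => p (x i)).updateRow i (p v)).det := by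
  unfold dt
  congr 1
  ext a b
  by_cases h : a = i
  · subst h; simp
  · simp [h]

lemma IsFan.opp (h : IsFan K p) {x : Fin (n+1) → V} (i : Fin (n+1)) {v : V} (hv : v ≠ x i)
    (h1 : Function.Injective x) (h2 : Finset.image x Finset.univ ∈ K.faces)
    (h3 : Function.Injective (Function.update x i v))
    (h4 : Finset.image (Function.update x i v) Finset.univ ∈ K.faces) :
    dt p x * dt p (Function.update x i v) < 0 := by
  by_contra hcon
  have d1 := h.dt_ne h1 h2
  have d2 := h.dt_ne h3 h4
  have hpos : 0 < dt p x * dt p (Function.update x i v) :=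
    lt_of_le_of_ne (not_lt.mp hcon) (mul_ne_zero d1 d2).symm
  set M : Matrix (Fin (n+1)) (Fin (n+1)) ℝ := Matrix.of fun i => p (x i) with hM
  set β := Matrix.vecMul (p v) M⁻¹ with hβ
  have hβv : ∑ j, β j • p (x j) = p v := by
    have : Matrix.vecMul β M = p v := by
      rw [hβ, Matrix.vecMul_vecMul, Matrix.nonsing_inv_mul _ (isUnit_iff_ne_zero.mpr d1),
        Matrix.vecMul_one]
    rw [← this]
    ext j
    simp [Matrix.vecMul, dotProduct, hM]
  have hdet : dt p (Function.update x i v) = β i * dt p x := by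
    rw [dt_update, ← hβv]
    exact Matrix.det_updateRow_sum M i β
  have hβi : 0 < β i := by
    rw [hdet] at hpos
    have : 0 < dt p x * dt p x := mul_self_pos.mpr (by assumption)
    by_contra hb
    nlinarith [mul_nonneg (neg_nonneg.mpr (not_lt.mp hb)) this.le]
  set B := ∑ j, |β j| with hB
  have hBj : ∀ j, 0 ≤ β j + B := by
    intro j
    have : |β j| ≤ B := Finset.single_le_sum (f := fun j => |β j|) (fun _ _ => abs_nonneg _) (Finset.mem_univ j)
    have := neg_abs_le (β j)
    linarith
  have hB0 : 0 ≤ B := Finset.sum_nonneg fun _ _ => abs_nonneg _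
  let w1 : Fin (n+1) → ℝ := fun j => if j = i then 1 else B
  let w2 : Fin (n+1) → ℝ := fun j => if j = i then β j else β j + B
  have e := h.uniq (push (Function.update x i v) w1) (push x w2)
    (push_isC (fun j => by dsimp only [w1]; split_ifs <;> linarith) h4 subset_rfl)
    (push_isC (fun j => by
      dsimp only [w2]; split_ifs with hj
      · rw [hj]; exact hβi.le
      · exact hBj j) h2 subset_rfl) (by
      rw [sum_push, sum_push]
      have a1 : ∑ j, w1 j • p (Function.update x i v j) =
          p v + ∑ j ∈ Finset.univ.erase i, B • p (x j) := by
        rw [← Finset.add_sum_erase _ _ (Finset.mem_univ i)]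
        congr 1
        · simp [w1]
        · refine Finset.sum_congr rfl fun j hj => ?_
          have := Finset.ne_of_mem_erase hj
          simp [w1, this]
      have a2 : ∑ j, w2 j • p (x j) =
          ∑ j, β j • p (x j) + ∑ j ∈ Finset.univ.erase i, B • p (x j) := by
        rw [← Finset.add_sum_erase _ _ (Finset.mem_univ i),
          ← Finset.add_sum_erase (a := i) _ (fun j => β j • p (x j)) (Finset.mem_univ i), add_assoc,
          ← Finset.sum_add_distrib]
        congr 1
        · simp [w2]
        · refine Finset.sum_congr rfl fun j hj => ?_
          have := Finset.ne_of_mem_erase hj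
          simp [w2, this, add_smul]
      rw [a1, a2, hβv])
  have e1 := congrFun e (x i)
  rw [push_apply h1, push_zero] at e1
  · simp [w2] at e1
    linarith
  · simp only [Finset.mem_image, Finset.mem_univ, true_and, not_exists]
    intro j hj
    by_cases hji : j = i
    · subst hji; simp at hj; exact hv hj
    · simp [hji] at hj; exact hji (h1 hj)

lemma IsFan.exists_opp (h : IsFan K p) {x : Fin (n+1) → V} (i : Fin (n+1))
    (h1 : Function.Injective x) (h2 : Finset.image x Finset.univ ∈ K.faces) :
    ∃ v, Finset.image (Function.update x i v) Finset.univ ∈ K.faces ∧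
      dt p x * dt p (Function.update x i v) < 0 := by
  set w0 : Fin (n+1) → ℝ := fun j => if j = i then 0 else 1 with hw0
  set r : Fin (n+1) → ℝ := ∑ j, w0 j • p (x j) with hr
  let z : ℕ → Fin (n+1) → ℝ := fun m => (m : ℝ) • r - p (x i)
  have hz : ∀ m : ℕ, ∃ (c : V → ℝ) (s : Finset V), s ∈ K.faces ∧ (∀ v, 0 ≤ c v) ∧
      (∀ v, v ∉ s → c v = 0) ∧ ∑ v, c v • p v = z m := by
    intro m
    obtain ⟨c, ⟨h0, s, hs, hcs⟩, hc⟩ := h.ex (z m)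
    exact ⟨c, s, hs, h0, hcs, hc⟩
  choose c s hs hc0 hcs hcz using hz
  obtain ⟨S, hS⟩ := Finite.exists_infinite_fiber s
  have hS' : (s ⁻¹' {S}).Infinite := Set.infinite_coe_iff.mp hS
  obtain ⟨m0, hm0, -⟩ := hS'.exists_gt 0
  obtain ⟨m1, hm1, hlt⟩ := hS'.exists_gt m0
  have hm0 : s m0 = S := hm0
  have hm1 : s m1 = S := hm1
  have hSf : S ∈ K.faces := hm0 ▸ hs m0
  have hd : (0:ℝ) < (m1 : ℝ) - m0 := by
    have : (m0 : ℝ) < m1 := by exact_mod_cast hlt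
    linarith
  let q : V → ℝ := fun v => (c m1 v - c m0 v) / ((m1 : ℝ) - m0)
  have hqS : ∀ v, v ∉ S → q v = 0 := fun v hv => by
    simp [q, hcs m1 v (hm1 ▸ hv), hcs m0 v (hm0 ▸ hv)]
  have hqr : ∑ v, q v • p v = r := by
    have : ∑ v, q v • p v = ((m1 : ℝ) - m0)⁻¹ • (∑ v, c m1 v • p v - ∑ v, c m0 v • p v) := by
      rw [← Finset.sum_sub_distrib, Finset.smul_sum]
      refine Finset.sum_congr rfl fun v _ => ?_
      rw [← sub_smul, smul_smul]
      congr 1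
      simp only [q]; field_simp
    rw [this, hcz, hcz]
    simp only [z]
    rw [sub_sub_sub_cancel_right, ← sub_smul, smul_smul, inv_mul_cancel₀ hd.ne', one_smul]
  have hlin : ∀ m, s m = S → ∀ v, c m v = c m0 v + ((m : ℝ) - m0) * q v := by
    intro m hm v
    have := h.indep hSf (fun v => c m v - (c m0 v + ((m : ℝ) - m0) * q v))
      (fun v hv => by simp [hcs m v (hm ▸ hv), hcs m0 v (hm0 ▸ hv), hqS v hv]) (by
        simp only [sub_smul, add_smul, mul_smul, Finset.sum_sub_distrib, Finset.sum_add_distrib,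
          ← Finset.smul_sum, hcz, hqr]
        simp only [z]
        module)
    have := congrFun this v
    simp only [Pi.zero_apply] at this
    linarith
  have hq0 : ∀ v, 0 ≤ q v := by
    intro v
    by_contra hneg
    push Not at hneg
    obtain ⟨N, hN⟩ := exists_nat_gt (m0 + c m0 v / (-q v))
    obtain ⟨m, hm, hNm⟩ := hS'.exists_gt N
    have e := hlin m hm v
    have e2 := hc0 m v
    have hmN : (N : ℝ) < m := by exact_mod_cast hNm
    have : c m0 v / (-q v) < m - m0 := by linarith
    rw [div_lt_iff₀ (by linarith)] at this
    nlinarith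
  have hqw := h.uniq q (push x w0) ⟨hq0, S, hSf, hqS⟩
    (push_isC (fun j => by simp only [hw0]; split_ifs <;> norm_num) h2 subset_rfl)
    (by rw [hqr, sum_push])
  have hridge : ∀ j, j ≠ i → x j ∈ S := by
    intro j hj
    by_contra hn
    have := hqS _ hn
    rw [hqw, push_apply h1] at this
    simp [hw0, hj] at this
  let ℓ : (Fin (n+1) → ℝ) →ₗ[ℝ] ℝ :=
    (Matrix.detRowAlternating (R := ℝ) (n := Fin (n+1))).toMultilinearMap.toLinearMap
      (fun j => p (x j)) i
  have hℓ : ∀ v, ℓ (p v) = dt p (Function.update x i v) := by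
    intro v
    rw [dt_update]; rfl
  have hℓj : ∀ j, j ≠ i → ℓ (p (x j)) = 0 := by
    intro j hj
    rw [hℓ]
    by_contra hne
    have := dt_inj hne
    apply hj
    apply this
    simp [hj]
  have hℓi : ℓ (p (x i)) = dt p x := by rw [hℓ, Function.update_eq_self]
  have hℓr : ℓ r = 0 := by
    rw [hr, map_sum]
    refine Finset.sum_eq_zero fun j _ => ?_
    by_cases hj : j = i
    · simp [hw0, hj]
    · rw [map_smul, hℓj j hj, smul_zero]
  have hd1 := h.dt_ne h1 h2
  have hneg : ∑ v, c m0 v * (dt p x * ℓ (p v)) < 0 := by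
    have e : ∑ v, c m0 v * (dt p x * ℓ (p v)) = dt p x * ℓ (z m0) := by
      rw [← hcz, map_sum, Finset.mul_sum]
      refine Finset.sum_congr rfl fun v _ => ?_
      rw [map_smul, smul_eq_mul]; ring
    rw [e]
    simp only [z, map_sub, map_smul, hℓr, hℓi, smul_zero, zero_sub]
    have : 0 < dt p x * dt p x := mul_self_pos.mpr (by assumption)
    linarith
  obtain ⟨v, -, hv⟩ := Finset.exists_lt_of_sum_lt (f := fun v => c m0 v * (dt p x * ℓ (p v)))
    (g := fun _ => (0:ℝ)) (s := Finset.univ) (by simpa using hneg)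
  have hvS : v ∈ S := by
    by_contra hn
    simp [hcs m0 v (hm0 ▸ hn)] at hv
  refine ⟨v, K.down_closed hSf ?_ ?_, ?_⟩
  · intro u hu
    simp only [Finset.mem_image, Finset.mem_univ, true_and] at hu
    obtain ⟨j, rfl⟩ := hu
    by_cases hj : j = i
    · subst hj; simpa using hvS
    · simpa [hj] using hridge j hj
  · exact ⟨_, Finset.mem_image_of_mem _ (Finset.mem_univ i)⟩
  · rw [← hℓ]
    by_contra hn
    have := mul_nonneg (hc0 m0 v) (not_lt.mp hn)
    linarith

lemma sgn_of_face {x : Fin (n+1) → V} (hx : Finset.image x Finset.univ ∈ K.faces) :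
    sgn K p x = ((SignType.sign (dt p x) : SignType) : ℤ) := by
  unfold sgn; rw [if_pos hx]

lemma sign_opp {a b : ℝ} (h : a * b < 0) :
    ((SignType.sign b : SignType) : ℤ) = - ((SignType.sign a : SignType) : ℤ) := by
  rcases mul_neg_iff.mp h with ⟨h1, h2⟩ | ⟨h1, h2⟩ <;> simp [sign_pos, sign_neg, h1, h2]

lemma IsFan.sgn_update (h : IsFan K p) {x : Fin (n+1) → V} (i : Fin (n+1)) {v : V} (hv : v ≠ x i)
    (h1 : sgn K p x ≠ 0) (h2 : sgn K p (Function.update x i v) ≠ 0) :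
    sgn K p (Function.update x i v) = - sgn K p x := by
  obtain ⟨a1, a2⟩ := sgn_ne h1
  obtain ⟨b1, b2⟩ := sgn_ne h2
  rw [sgn_of_face a2, sgn_of_face b2]
  exact sign_opp (h.opp i hv a1 a2 b1 b2)

lemma IsFan.cycle (h : IsFan K p) (x : Fin (n+1) → V) (i : Fin (n+1)) :
    ∑ v, sgn K p (Function.update x i v) = 0 := by
  by_cases hall : ∀ v, sgn K p (Function.update x i v) = 0
  · exact Finset.sum_eq_zero fun v _ => hall v
  push Not at hall
  obtain ⟨u, hu⟩ := hall
  obtain ⟨u1, u2⟩ := sgn_ne hu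
  obtain ⟨v, hv1, hv2⟩ := h.exists_opp i u1 u2
  rw [Function.update_idem] at hv1 hv2
  have hvs : sgn K p (Function.update x i v) = - sgn K p (Function.update x i u) := by
    rw [sgn_of_face u2, sgn_of_face hv1]
    exact sign_opp hv2
  have huv : u ≠ v := by
    rintro rfl
    nlinarith [mul_self_nonneg (dt p (Function.update x i u))]
  have hrest : ∀ w, w ≠ u ∧ w ≠ v → sgn K p (Function.update x i w) = 0 := by
    rintro w ⟨hwu, hwv⟩
    by_contra hw
    have e1 := h.sgn_update (x := Function.update x i u) i (v := w) (by simpa using hwu) hu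
      (by rwa [Function.update_idem])
    have e2 := h.sgn_update (x := Function.update x i v) i (v := w) (by simpa using hwv)
      (by rw [hvs]; exact neg_ne_zero.mpr hu) (by rwa [Function.update_idem])
    rw [Function.update_idem] at e1 e2
    rw [e1, hvs] at e2
    omega
  rw [Fintype.sum_eq_add u v huv hrest, hvs]
  ring

/-- The orientation induced by a fan. -/
noncomputable def IsFan.orient (h : IsFan K p) : CoherentOrientation n K where
  sign := sgn K p
  sign_perm := sgn_perm
  sign_unit := fun x hx hf => by
    rw [sgn_of_face hf]
    rcases lt_or_gt_of_ne (h.dt_ne hx hf) with h | h <;> simp [sign_pos, sign_neg, h]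
  sign_zero := fun x hx => by
    by_contra hne
    obtain ⟨a, b⟩ := sgn_ne hne
    rcases hx with hx | hx
    · exact hx a
    · exact hx b
  coherent := fun x y => by
    rintro ⟨i, hi, hj⟩ hx hy
    have e : y = Function.update x i (y i) := by
      funext j
      by_cases h : j = i
      · subst h; simp
      · simp [h, hj j h]
    rw [e]
    exact h.sgn_update i hi.symm hx (e ▸ hy)

end

end Stmt8

namespace Stmt8

section
variable {V : Type} [Fintype V] [DecidableEq V]
variable {n : ℕ} {K : AbsCx V} {p : V → Fin (n+1) → ℝ}

lemma sum_fiber (i : Fin (n+1)) (G : (Fin (n+1) → V) → ℤ)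
    (hG : ∀ x, ∑ v, G (Function.update x i v) = 0) : ∑ x, G x = 0 := by
  rw [← Equiv.sum_comp (Fin.insertNthEquiv (fun _ => V) i) G, Fintype.sum_prod_type, Finset.sum_comm]
  refine Finset.sum_eq_zero fun w _ => ?_
  rcases isEmpty_or_nonempty V with hV | ⟨⟨v0⟩⟩
  · simp
  · rw [← hG (i.insertNth v0 w)]
    refine Finset.sum_congr rfl fun v _ => ?_
    simp [Fin.insertNthEquiv]

lemma algSum_eq (g : (Fin (n+1) → V) → ℤ) (f : V → Fin (n+2)) (y : Fin (n+1) → Fin (n+2)) :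
    algSum g f y = ∑ x : Fin (n+1) → V, if f ∘ x = y then g x else 0 := by
  unfold algSum
  refine Finset.sum_congr rfl fun x _ => ?_
  split_ifs <;> rfl

lemma algSum_perm (f : V → Fin (n+2)) (y : Fin (n+1) → Fin (n+2)) (σ : Equiv.Perm (Fin (n+1))) :
    algSum (sgn K p) f (y ∘ σ) = (Equiv.Perm.sign σ : ℤ) * algSum (sgn K p) f y := by
  unfold algSum
  rw [← Equiv.sum_comp (Equiv.arrowCongr σ.symm (Equiv.refl V)), Finset.mul_sum]
  refine Finset.sum_congr rfl fun x _ => ?_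
  have e : (Equiv.arrowCongr σ.symm (Equiv.refl V)) x = x ∘ σ := by
    funext j; simp [Equiv.arrowCongr]
  rw [e, sgn_perm]
  have : f ∘ x ∘ σ = y ∘ σ ↔ f ∘ x = y := by
    rw [← Function.comp_assoc]
    exact σ.surjective.injective_comp_right.eq_iff
  simp only [this, mul_ite, mul_zero]

lemma algSum_cycle (h : IsFan K p) (f : V → Fin (n+2)) (y : Fin (n+1) → Fin (n+2))
    (i : Fin (n+1)) : ∑ b, algSum (sgn K p) f (Function.update y i b) = 0 := by
  simp only [algSum_eq]
  rw [Finset.sum_comm]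
  have e : ∀ x : Fin (n+1) → V, (∑ b, if f ∘ x = Function.update y i b then sgn K p x else 0) =
      if ∀ j, j ≠ i → f (x j) = y j then sgn K p x else 0 := by
    intro x
    have : ∀ b, f ∘ x = Function.update y i b ↔ b = f (x i) ∧ ∀ j, j ≠ i → f (x j) = y j := by
      intro b
      constructor
      · intro hb
        refine ⟨by have := congrFun hb i; simpa using this.symm, fun j hj => ?_⟩
        have := congrFun hb j
        simpa [hj] using this
      · rintro ⟨rfl, hb⟩
        funext j
        by_cases hj : j = i
        · subst hj; simp
        · simp [hj, hb j hj]
    simp only [this]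
    split_ifs with hP
    · rw [Fintype.sum_eq_single (f (x i)) (fun b hb => if_neg fun h => hb h.1), if_pos ⟨rfl, hP⟩]
    · exact Finset.sum_eq_zero fun b _ => if_neg fun h => hP h.2
  simp only [e]
  refine sum_fiber i _ fun x => ?_
  have e2 : ∀ v, (∀ j, j ≠ i → f (Function.update x i v j) = y j) ↔ ∀ j, j ≠ i → f (x j) = y j := by
    intro v
    refine forall_congr' fun j => forall_congr' fun hj => ?_
    simp [hj]
  simp only [e2]
  split_ifs
  · exact h.cycle x i
  · simp

end

section
variable {n : ℕ} (A : (Fin (n+1) → Fin (n+2)) → ℤ)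


lemma A_noninj
    (hp : ∀ y (σ : Equiv.Perm (Fin (n+1))), A (y ∘ σ) = (Equiv.Perm.sign σ : ℤ) * A y)
    {y : Fin (n+1) → Fin (n+2)} (h : ¬ Function.Injective y) : A y = 0 := by
  simp only [Function.Injective, not_forall] at h
  obtain ⟨i, j, hij, hne⟩ := h
  have e : y ∘ Equiv.swap i j = y := by
    funext k
    simp only [Function.comp, Equiv.swap_apply_def]
    split_ifs with h1 h2
    · rw [h1, hij]
    · rw [h2, hij]
    · rfl
  have := hp y (Equiv.swap i j)
  rw [e, Equiv.Perm.sign_swap hne] at this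
  simp at this
  omega


lemma A_update
    (hp : ∀ y (σ : Equiv.Perm (Fin (n+1))), A (y ∘ σ) = (Equiv.Perm.sign σ : ℤ) * A y)
    (hc : ∀ y i, ∑ b, A (Function.update y i b) = 0)
    {y : Fin (n+1) → Fin (n+2)} (hy : Function.Injective y) (i : Fin (n+1))
    {b : Fin (n+2)} (hb : b ∉ Set.range y) : A (Function.update y i b) = - A y := by
  have h := hc y i
  have hbi : y i ≠ b := fun h => hb ⟨i, h⟩
  rw [Fintype.sum_eq_add (y i) b hbi] at h
  · rw [Function.update_eq_self] at h; omega
  · rintro a ⟨ha1, ha2⟩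
    apply A_noninj A hp
    intro hinj
    have hcard : Fintype.card (Fin (n+2)) ≤ n + 1 := by
      have hs : ∀ a' : Fin (n+2), a' ∈ Set.range y ∪ {b} := by
        have hnot : ¬ Function.Injective (Fin.cons a (Fin.cons b y) : Fin (n+3) → Fin (n+2)) := by
          intro hi
          have := Fintype.card_le_of_injective _ hi
          simp at this
        intro a'
        by_contra hn
        simp only [Set.mem_union, Set.mem_singleton_iff, not_or] at hn
        have hi : Function.Injective (Fin.cons a' (Fin.cons b y) : Fin (n+3) → Fin (n+2)) := by
          rw [Fin.cons_injective_iff, Fin.cons_injective_iff]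
          refine ⟨?_, hb, hy⟩
          rw [Fin.range_cons]
          rintro (h | h)
          · exact hn.2 h
          · exact hn.1 h
        have := Fintype.card_le_of_injective _ hi
        simp at this
      exfalso
      rcases hs a with ⟨j, hj⟩ | h
      · have hji : j ≠ i := by rintro rfl; exact ha1 hj.symm
        apply hji
        apply hinj
        simp [hji, hj]
      · exact ha2 h
    simp at hcard


lemma A_swap
    (hp : ∀ y (σ : Equiv.Perm (Fin (n+1))), A (y ∘ σ) = (Equiv.Perm.sign σ : ℤ) * A y)
    (hc : ∀ y i, ∑ b, A (Function.update y i b) = 0)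
    {y : Fin (n+1) → Fin (n+2)} (hy : Function.Injective y) {a b : Fin (n+2)}
    (hab : a ≠ b) : A (Equiv.swap a b ∘ y) = - A y := by
  have one : ∀ {a b : Fin (n+2)}, a ≠ b → a ∈ Set.range y → b ∉ Set.range y →
      A (Equiv.swap a b ∘ y) = - A y := by
    rintro a b hab ⟨i, rfl⟩ hb
    rw [← A_update A hp hc hy i hb]
    congr 1
    funext j
    by_cases hj : j = i
    · subst hj; simp
    · simp only [Function.comp, ne_eq, hj, not_false_eq_true, Function.update_of_ne]
      exact Equiv.swap_apply_of_ne_of_ne (fun h => hj (hy h)) fun h => hb ⟨j, h⟩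
  by_cases ha : a ∈ Set.range y
  · by_cases hb : b ∈ Set.range y
    · obtain ⟨i, rfl⟩ := ha
      obtain ⟨j, rfl⟩ := hb
      have hij : i ≠ j := fun h => hab (by rw [h])
      have e : Equiv.swap (y i) (y j) ∘ y = y ∘ Equiv.swap i j := by
        funext k
        simp only [Function.comp, Equiv.swap_apply_def, hy.eq_iff]
        split_ifs <;> rfl
      rw [e, hp, Equiv.Perm.sign_swap hij]
      simp
    · exact one hab ha hb
  · by_cases hb : b ∈ Set.range y
    · rw [Equiv.swap_comm]; exact one hab.symm hb ha
    · exfalso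
      have hi : Function.Injective (Fin.cons a (Fin.cons b y) : Fin (n+3) → Fin (n+2)) := by
        rw [Fin.cons_injective_iff, Fin.cons_injective_iff]
        refine ⟨?_, hb, hy⟩
        rw [Fin.range_cons]
        rintro (h | h)
        · exact hab h
        · exact ha h
      have := Fintype.card_le_of_injective _ hi
      simp at this


lemma A_abs
    (hp : ∀ y (σ : Equiv.Perm (Fin (n+1))), A (y ∘ σ) = (Equiv.Perm.sign σ : ℤ) * A y)
    (hc : ∀ y i, ∑ b, A (Function.update y i b) = 0)
    {y y0 : Fin (n+1) → Fin (n+2)} (hy : Function.Injective y)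
    (hy0 : Function.Injective y0) : A y = A y0 ∨ A y = - A y0 := by
  obtain ⟨π, hπ⟩ := Equiv.Perm.exists_extending_pair y0 y hy0 hy
  have e : y = π ∘ y0 := by funext j; exact (hπ j).symm
  rw [e]
  clear e hπ
  induction π using Equiv.Perm.swap_induction_on with
  | one => left; rfl
  | swap_mul π a b hab ih =>
    have : A (⇑(Equiv.swap a b * π) ∘ y0) = - A (π ∘ y0) :=
      A_swap A hp hc (π.injective.comp hy0) hab
    rw [this]
    rcases ih with ih | ih <;> rw [ih] <;> simp

/-- orientation of the standard sphere extracted from a nonzero alternating cycle -/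
noncomputable def stdOrient (y0 : Fin (n+1) → Fin (n+2)) (hy0 : Function.Injective y0) (D : ℤ)
    (hD : D ≠ 0) (h0 : A y0 = D ∨ A y0 = -D)
    (hp : ∀ y (σ : Equiv.Perm (Fin (n+1))), A (y ∘ σ) = (Equiv.Perm.sign σ : ℤ) * A y)
    (hc : ∀ y i, ∑ b, A (Function.update y i b) = 0) :
    CoherentOrientation n (stdSphere n) where
  sign := fun y => A y / D
  sign_perm := fun y σ => by
    rw [hp]
    rcases Int.units_eq_one_or (Equiv.Perm.sign σ) with h | h
    · simp [h]
    · have : D ∣ A y := by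
        by_cases hy : Function.Injective y
        · rcases A_abs A hp hc hy hy0 with h1 | h1 <;> rcases h0 with h0 | h0 <;> rw [h1, h0] <;> simp
        · rw [A_noninj A hp hy]; simp
      simp [h, Int.neg_ediv_of_dvd this]
  sign_unit := fun y hy _ => by
    rcases A_abs A hp hc hy hy0 with h1 | h1 <;> rcases h0 with h0 | h0 <;> rw [h1, h0] <;>
      simp [Int.neg_ediv_of_dvd, hD]
  sign_zero := fun y hy => by
    have hni : ¬ Function.Injective y := by
      rcases hy with hy | hy
      · exact hy
      · exfalso
        apply hy
        refine ⟨⟨_, Finset.mem_image_of_mem _ (Finset.mem_univ 0)⟩, fun h => ?_⟩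
        have := Finset.card_image_le (s := (Finset.univ : Finset (Fin (n+1)))) (f := y)
        rw [h] at this
        simp at this
    rw [A_noninj A hp hni]; simp
  coherent := fun x y => by
    rintro ⟨i, hi, hj⟩ hx hy
    have hxi : Function.Injective x := by
      by_contra h; exact hx (by rw [A_noninj A hp h]; simp)
    have hyi : Function.Injective y := by
      by_contra h; exact hy (by rw [A_noninj A hp h]; simp)
    have e : y = Function.update x i (y i) := by
      funext j
      by_cases h : j = i
      · subst h; simp
      · simp [h, hj j h]
    have hr : y i ∉ Set.range x := by
      rintro ⟨j, hj'⟩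
      by_cases h : j = i
      · subst h; exact hi hj'
      · rw [hj j h] at hj'; exact h (hyi hj')
    have e2 : A y = - A x := by
      rw [e]; exact A_update A hp hc hxi i hr
    have : D ∣ A x := by
      rcases A_abs A hp hc hxi hy0 with h1 | h1 <;> rcases h0 with h0 | h0 <;> rw [h1, h0] <;> simp
    rw [e2, Int.neg_ediv_of_dvd this]

end

/-- The data produced by the construction. -/
def Good (V : Type) [Fintype V] [DecidableEq V] (n : ℕ) (D : ℤ) : Prop :=
  ∃ (K : AbsCx V) (p : V → Fin (n+1) → ℝ) (f : V → Fin (n+2)) (y0 : Fin (n+1) → Fin (n+2)),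
    K.vertexSet = Set.univ ∧ IsFan K p ∧ K.IsSimplicialMap (stdSphere n) f ∧
    Function.Injective y0 ∧ algSum (sgn K p) f y0 = D

lemma Good.final {V : Type} [Fintype V] [DecidableEq V] {n : ℕ} {D : ℤ} (h : Good V n D)
    (D' : ℤ) (hD' : D' ≠ 0) (hDD : D = D' ∨ D = - D') :
    ∃ K : AbsCx V,
      K.vertexSet = Set.univ ∧ K.IsSphereTriangulation n ∧
      ∃ (oK : CoherentOrientation n K) (oL : CoherentOrientation n (stdSphere n))
        (f : V → Fin (n + 2)),
        K.IsSimplicialMap (stdSphere n) f ∧ HasDegree oK oL f D' := by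
  obtain ⟨K, p, f, y0, hv, hF, hs, hy0, hA⟩ := h
  have h0 : algSum (sgn K p) f y0 = D' ∨ algSum (sgn K p) f y0 = - D' := by rw [hA]; exact hDD
  refine ⟨K, hv, hF.sphere, hF.orient, stdOrient (algSum (sgn K p) f) y0 hy0 D' hD' h0
    (algSum_perm f) (algSum_cycle hF f), f, hs, ?_⟩
  intro y hy
  have hy' : algSum (sgn K p) f y / D' = 1 := hy
  have hyi : Function.Injective y := by
    by_contra h
    rw [A_noninj _ (algSum_perm f) h] at hy'
    simp at hy'
  have hdvd : D' ∣ algSum (sgn K p) f y := by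
    rcases A_abs _ (algSum_perm f) (algSum_cycle hF f) hyi hy0 with h1 | h1 <;>
      rcases h0 with h0 | h0 <;> rw [h1, h0] <;> simp
  have := Int.ediv_mul_cancel hdvd
  rw [hy', one_mul] at this
  exact this.symm

end Stmt8

namespace Stmt8

section
variable {V W : Type} [Fintype V] [DecidableEq V] [Fintype W] [DecidableEq W]

/-- transport of a complex along an equivalence -/
def mapCx (e : V ≃ W) (K : AbsCx V) : AbsCx W where
  faces := {s | s.image e.symm ∈ K.faces}
  down_closed := fun _ _ hs hts ht => K.down_closed hs (Finset.image_subset_image hts) (ht.image _)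
  nonempty_of_mem := fun _ hs => Finset.image_nonempty.mp (K.nonempty_of_mem hs)

lemma isC_map (e : V ≃ W) {K : AbsCx V} {c : V → ℝ} : IsC (mapCx e K) (c ∘ e.symm) ↔ IsC K c := by
  constructor
  · rintro ⟨h0, s, hs, h1⟩
    refine ⟨fun v => by simpa using h0 (e v), s.image e.symm, hs, fun v hv => ?_⟩
    have := h1 (e v) (fun h => hv (Finset.mem_image.mpr ⟨e v, h, by simp⟩))
    simpa using this
  · rintro ⟨h0, s, hs, h1⟩
    refine ⟨fun v => h0 _, s.image e, ?_, fun v hv => ?_⟩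
    · show (s.image e).image e.symm ∈ K.faces
      rw [Finset.image_image]; simpa using hs
    · exact h1 _ (fun h => hv (Finset.mem_image.mpr ⟨_, h, by simp⟩))

lemma Good.transport {n : ℕ} {D : ℤ} (e : V ≃ W) (h : Good V n D) : Good W n D := by
  obtain ⟨K, p, f, y0, hv, hF, hs, hy0, hA⟩ := h
  have key : ∀ c : V → ℝ, ∑ w, (c ∘ e.symm) w • (p ∘ e.symm) w = ∑ v, c v • p v := fun c =>
    Equiv.sum_comp e.symm (fun v => c v • p v)
  have hce : ∀ c : W → ℝ, c = (c ∘ e) ∘ e.symm := fun c => by funext w; simp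
  refine ⟨mapCx e K, p ∘ e.symm, f ∘ e.symm, y0, ?_, ⟨?_, ?_⟩, ?_, hy0, ?_⟩
  · ext w
    have : e.symm w ∈ K.vertexSet := by rw [hv]; trivial
    simp only [Set.mem_univ, iff_true]
    show Finset.image e.symm {w} ∈ K.faces
    rw [Finset.image_singleton]
    exact this
  · intro x
    obtain ⟨c, hc, hx⟩ := hF.ex x
    exact ⟨c ∘ e.symm, (isC_map e).mpr hc, (key c).trans hx⟩
  · intro c c' hc hc' hcc
    rw [hce c] at hc hcc
    rw [hce c'] at hc' hcc
    rw [key, key] at hcc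
    have := hF.uniq _ _ ((isC_map e).mp hc) ((isC_map e).mp hc') hcc
    rw [hce c, hce c', this]
  · intro s hs'
    have := hs _ hs'
    rwa [Finset.image_image] at this
  · rw [← hA, algSum_eq, algSum_eq, ← Equiv.sum_comp (Equiv.arrowCongr (Equiv.refl (Fin (n+1))) e)]
    refine Finset.sum_congr rfl fun x _ => ?_
    have e1 : (Equiv.arrowCongr (Equiv.refl (Fin (n+1))) e) x = e ∘ x := by
      funext j; simp [Equiv.arrowCongr]
    have e2 : (f ∘ e.symm) ∘ e ∘ x = f ∘ x := by funext j; simp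
    have e3 : sgn (mapCx e K) (p ∘ e.symm) (e ∘ x) = sgn K p x := by
      have e4 : dt (p ∘ e.symm) (e ∘ x) = dt p x := by simp [dt]
      have e5 : (Finset.image (e ∘ x) Finset.univ ∈ (mapCx e K).faces) ↔
          Finset.image x Finset.univ ∈ K.faces := by
        show Finset.image e.symm (Finset.image (e ∘ x) Finset.univ) ∈ K.faces ↔ _
        rw [Finset.image_image]
        have : e.symm ∘ e ∘ x = x := by funext j; simp
        rw [this]
      unfold sgn
      rw [e4]
      classical exact if_congr e5 rfl rfl
    rw [e1, e2, e3]

/-- one-point suspension -/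
def susp (K : AbsCx V) (v : V) : AbsCx (Option V) where
  faces := {s | s.Nonempty ∧ ∃ F ∈ K.faces, s ⊆ insert none (F.image some) ∨
    (v ∉ F ∧ s ⊆ insert (some v) (F.image some))}
  down_closed := fun s t hs hts ht => by
    obtain ⟨-, F, hF, h | ⟨h1, h2⟩⟩ := hs
    · exact ⟨ht, F, hF, Or.inl (hts.trans h)⟩
    · exact ⟨ht, F, hF, Or.inr ⟨h1, hts.trans h2⟩⟩
  nonempty_of_mem := fun s hs => hs.1

lemma isC_susp {K : AbsCx V} {v : V} {c : Option V → ℝ} : IsC (susp K v) c ↔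
    (∀ o, 0 ≤ c o) ∧ ∃ F ∈ K.faces, (∀ u, u ∉ F → c (some u) = 0) ∨
      (v ∉ F ∧ c none = 0 ∧ ∀ u, u ∉ F → u ≠ v → c (some u) = 0) := by
  constructor
  · rintro ⟨h0, s, ⟨-, F, hF, h | ⟨h1, h2⟩⟩, hs⟩
    · refine ⟨h0, F, hF, Or.inl fun u hu => hs _ fun hus => ?_⟩
      have := h hus
      simp at this
      exact hu this
    · refine ⟨h0, F, hF, Or.inr ⟨h1, hs _ fun hus => ?_, fun u hu huv => hs _ fun hus => ?_⟩⟩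
      · have := h2 hus
        simp at this
      · have := h2 hus
        simp [huv, hu] at this
  · rintro ⟨h0, F, hF, h | ⟨h1, h2, h3⟩⟩
    · refine ⟨h0, insert none (F.image some), ⟨by simp, F, hF, Or.inl subset_rfl⟩, ?_⟩
      rintro (_ | u) hu
      · simp at hu
      · exact h u (by simpa using hu)
    · refine ⟨h0, insert (some v) (F.image some), ⟨by simp, F, hF, Or.inr ⟨h1, subset_rfl⟩⟩, ?_⟩
      rintro (_ | u) hu
      · exact h2
      · simp at hu
        exact h3 u hu.2 hu.1

/-- fan vectors of the one-point suspension -/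
def suspVec {n : ℕ} (p : V → Fin n → ℝ) (v : V) : Option V → Fin (n+1) → ℝ
  | none => Fin.cons 1 0
  | some u => Fin.cons (if u = v then -1 else 0) (p u)

lemma sum_suspVec {n : ℕ} (p : V → Fin n → ℝ) (v : V) (c : Option V → ℝ) :
    ∑ o, c o • suspVec p v o =
      (Fin.cons (c none - c (some v)) (∑ u, c (some u) • p u) : Fin (n+1) → ℝ) := by
  funext j
  rw [Fintype.sum_option]
  refine Fin.cases ?_ (fun j => ?_) j
  · simp [suspVec, Finset.sum_apply]
    ring
  · simp [suspVec, Finset.sum_apply]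

lemma sum_update {n : ℕ} (p : V → Fin n → ℝ) (v : V) (c : V → ℝ) (a : ℝ) :
    ∑ u, Function.update c v a u • p u = ∑ u, c u • p u + (a - c v) • p v := by
  rw [← Finset.add_sum_erase _ _ (Finset.mem_univ v),
    ← Finset.add_sum_erase (a := v) _ (fun u => c u • p u) (Finset.mem_univ v)]
  have : ∑ u ∈ Finset.univ.erase v, Function.update c v a u • p u =
      ∑ u ∈ Finset.univ.erase v, c u • p u :=
    Finset.sum_congr rfl fun u hu => by
      rw [Function.update_of_ne (Finset.ne_of_mem_erase hu)]
  rw [this, Function.update_self]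
  module

lemma IsFan.susp {n : ℕ} {K : AbsCx V} {p : V → Fin n → ℝ} (h : IsFan K p) (v : V) :
    IsFan (susp K v) (suspVec p v) := by
  constructor
  · intro z
    obtain ⟨t, x, rfl⟩ : ∃ (t : ℝ) (x : Fin n → ℝ), z = Fin.cons t x :=
      ⟨z 0, Fin.tail z, (Fin.cons_self_tail z).symm⟩
    rcases le_or_gt 0 t with ht | ht
    · obtain ⟨c, ⟨h0, F, hF, hc⟩, hx⟩ := h.ex x
      refine ⟨fun o => o.elim (t + c v) c, isC_susp.mpr ⟨?_, F, hF, Or.inl hc⟩, ?_⟩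
      · rintro (_ | u)
        · exact add_nonneg ht (h0 v)
        · exact h0 u
      · rw [sum_suspVec]; simp [hx]
    · obtain ⟨c, ⟨h0, F, hF, hc⟩, hx⟩ := h.ex (x + t • p v)
      refine ⟨fun o => o.elim (c v) (Function.update c v (c v - t)), isC_susp.mpr ⟨?_, F, hF, ?_⟩, ?_⟩
      · rintro (_ | u)
        · exact h0 v
        · by_cases hu : u = v
          · subst hu; simp; linarith [h0 u]
          · simpa [hu] using h0 u
      · by_cases hvF : v ∈ F
        · left
          intro u hu
          have : u ≠ v := by rintro rfl; exact hu hvF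
          simpa [this] using hc u hu
        · right
          refine ⟨hvF, hc v hvF, fun u hu huv => ?_⟩
          simpa [huv] using hc u hu
      · rw [sum_suspVec]
        simp only [Option.elim, sum_update, hx, Function.update_self]
        congr 1
        · ring
        · module
  · intro c c' hc hc' hcc
    rw [sum_suspVec, sum_suspVec] at hcc
    obtain ⟨ht, hx⟩ := Fin.cons_injective2 hcc
    rw [isC_susp] at hc hc'
    rcases le_or_gt 0 (c none - c (some v)) with h0 | h0
    · have key : ∀ c : Option V → ℝ, ((∀ o, 0 ≤ c o) ∧ ∃ F ∈ K.faces, (∀ u, u ∉ F → c (some u) = 0) ∨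
          (v ∉ F ∧ c none = 0 ∧ ∀ u, u ∉ F → u ≠ v → c (some u) = 0)) →
          0 ≤ c none - c (some v) → IsC K (fun u => c (some u)) := by
        rintro c ⟨hn, F, hF, h | ⟨h1, h2, h3⟩⟩ h0
        · exact ⟨fun u => hn _, F, hF, h⟩
        · refine ⟨fun u => hn _, F, hF, fun u hu => ?_⟩
          by_cases huv : u = v
          · subst huv; linarith [hn (some u)]
          · exact h3 u hu huv
      have e := h.uniq _ _ (key c hc h0) (key c' hc' (ht ▸ h0)) hx
      funext o
      rcases o with _ | u
      · have := congrFun e v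
        beta_reduce at this
        linarith
      · exact congrFun e u
    · have key : ∀ c : Option V → ℝ, ((∀ o, 0 ≤ c o) ∧ ∃ F ∈ K.faces, (∀ u, u ∉ F → c (some u) = 0) ∨
          (v ∉ F ∧ c none = 0 ∧ ∀ u, u ∉ F → u ≠ v → c (some u) = 0)) →
          c none - c (some v) < 0 → IsC K (Function.update (fun u => c (some u)) v (c none)) := by
        rintro c ⟨hn, F, hF, h | ⟨h1, h2, h3⟩⟩ h0
        · refine ⟨fun u => ?_, F, hF, fun u hu => ?_⟩
          · by_cases huv : u = v
            · subst huv; simpa using hn none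
            · simpa [huv] using hn (some u)
          · have huv : u ≠ v := by
              rintro rfl
              linarith [h u hu, hn none]
            simpa [huv] using h u hu
        · refine ⟨fun u => ?_, F, hF, fun u hu => ?_⟩
          · by_cases huv : u = v
            · subst huv; simpa using hn none
            · simpa [huv] using hn (some u)
          · by_cases huv : u = v
            · subst huv; simpa using h2
            · simpa [huv] using h3 u hu huv
      have e := h.uniq _ _ (key c hc h0) (key c' hc' (ht ▸ h0)) (by
        rw [sum_update, sum_update, hx, ht])
      have ev : c none = c' none := by simpa using congrFun e v
      funext o
      rcases o with _ | u
      · exact ev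
      · by_cases huv : u = v
        · subst huv; linarith
        · simpa [huv] using congrFun e u

lemma susp_face_iff {n : ℕ} (K : AbsCx V) (v : V) (x : Fin (n+1) → V) :
    Finset.image (Fin.cons none (fun j => some (x j)) : Fin (n+2) → Option V) Finset.univ
      ∈ (susp K v).faces ↔ Finset.image x Finset.univ ∈ K.faces := by
  have him : Finset.image (Fin.cons none (fun j => some (x j)) : Fin (n+2) → Option V) Finset.univ
      = insert none ((Finset.image x Finset.univ).image some) := by
    ext o
    simp [Fin.exists_fin_succ, eq_comm]
  rw [him]
  constructor
  · rintro ⟨-, F, hF, h | ⟨h1, h2⟩⟩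
    · refine K.down_closed hF (fun u hu => ?_) ⟨_, Finset.mem_image_of_mem _ (Finset.mem_univ 0)⟩
      have := h (Finset.mem_insert_of_mem (Finset.mem_image_of_mem some hu))
      simpa using this
    · have := h2 (Finset.mem_insert_self _ _)
      simp at this
  · intro h
    exact ⟨by simp, _, h, Or.inl subset_rfl⟩

lemma sgn_susp {n : ℕ} (K : AbsCx V) (p : V → Fin (n+1) → ℝ) (v : V) (x : Fin (n+1) → V) :
    sgn (susp K v) (suspVec p v) (Fin.cons none (fun j => some (x j)) : Fin (n+2) → Option V) =
      sgn K p x := by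
  have hd : dt (suspVec p v) (Fin.cons none (fun j => some (x j)) : Fin (n+2) → Option V) =
      dt p x := by
    unfold dt
    rw [Matrix.det_succ_row_zero, Fin.sum_univ_succ]
    simp [suspVec]
    congr 1
  unfold sgn
  rw [hd]
  classical exact if_congr (susp_face_iff K v x) rfl rfl

lemma Good.step {n : ℕ} {D : ℤ} (h : Good V n D) (v : V) : Good (Option V) (n+1) D := by
  obtain ⟨K, p, f, y0, hv, hF, hs, hy0, hA⟩ := h
  have hvert : ∀ u, ({u} : Finset V) ∈ K.faces := fun u => by
    have : u ∈ K.vertexSet := by rw [hv]; trivial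
    exact this
  refine ⟨susp K v, suspVec p v, fun o => o.elim 0 (fun u => (f u).succ),
    Fin.cons 0 (fun j => (y0 j).succ), ?_, hF.susp v, ?_, ?_, ?_⟩
  · ext o
    simp only [Set.mem_univ, iff_true]
    refine ⟨by simp, ?_⟩
    rcases o with _ | u
    · exact ⟨{v}, hvert v, Or.inl (by simp)⟩
    · exact ⟨{u}, hvert u, Or.inl (by simp)⟩
  · rintro s ⟨hne, F, hF, h | ⟨h1, h2⟩⟩
    · refine ⟨hne.image _, fun hu => ?_⟩
      obtain ⟨-, hFu⟩ := hs F hF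
      apply hFu
      rw [Finset.eq_univ_iff_forall] at hu ⊢
      intro b
      obtain ⟨o, ho, hob⟩ := Finset.mem_image.mp (hu b.succ)
      have := h ho
      rcases o with _ | u
      · exact absurd hob.symm (Fin.succ_ne_zero _)
      · simp at hob this
        exact Finset.mem_image.mpr ⟨u, this, hob⟩
    · refine ⟨hne.image _, fun hu => ?_⟩
      rw [Finset.eq_univ_iff_forall] at hu
      obtain ⟨o, ho, hob⟩ := Finset.mem_image.mp (hu 0)
      have := h2 ho
      rcases o with _ | u
      · simp at this
      · simp at hob
  · rw [Fin.cons_injective_iff]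
    refine ⟨?_, fun i j hij => hy0 (Fin.succ_injective _ hij)⟩
    rintro ⟨j, hj⟩
    exact Fin.succ_ne_zero _ hj
  · rw [← hA, algSum_eq, algSum_eq, ← Finset.sum_filter, ← Finset.sum_filter]
    symm
    refine Finset.sum_bij (fun x _ => (Fin.cons none (fun j => some (x j)) : Fin (n+2) → Option V))
      ?_ ?_ ?_ ?_
    · intro x hx
      simp only [Finset.mem_filter, Finset.mem_univ, true_and] at hx ⊢
      rw [← hx]
      funext j
      refine Fin.cases ?_ (fun j => ?_) j <;> simp
    · intro x _ x' _ hxx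
      have := (Fin.cons_injective2 hxx).2
      funext j
      exact Option.some_injective _ (congrFun this j)
    · intro x' hx'
      simp only [Finset.mem_filter, Finset.mem_univ, true_and] at hx'
      have h0 : x' 0 = none := by
        have := congrFun hx' 0
        rcases ho : x' 0 with _ | u
        · rfl
        · simp [ho] at this
      have hj : ∀ j : Fin (n+1), ∃ u, x' j.succ = some u ∧ f u = y0 j := by
        intro j
        have := congrFun hx' j.succ
        rcases ho : x' j.succ with _ | u
        · simp [ho] at this
          exact absurd this.symm (Fin.succ_ne_zero _)
        · simp [ho] at this
          exact ⟨u, rfl, this⟩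
      choose x hx1 hx2 using hj
      refine ⟨x, ?_, ?_⟩
      · simp only [Finset.mem_filter, Finset.mem_univ, true_and]
        funext j; exact hx2 j
      · funext j
        refine Fin.cases ?_ (fun j => ?_) j
        · simp [h0]
        · simp [hx1]
    · intro x _
      rw [sgn_susp]

end

end Stmt8

namespace Stmt8

/-- cyclic successor -/
def nx (M i : ℕ) : ℕ := if i + 1 = M then 0 else i + 1

/-- coefficient vectors supported on an edge of the cycle -/
def PC (M : ℕ) (c : ℕ → ℝ) : Prop :=
  (∀ i, 0 ≤ c i) ∧ ∃ i < M, ∀ j, j ≠ i → j ≠ nx M i → c j = 0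

/-- planar complete fan over the cycle of length `M` -/
def Planar (M : ℕ) (a b : ℕ → ℝ) : Prop :=
  (∀ i < M, 0 < a i * b (nx M i) - a (nx M i) * b i) ∧
  (∀ x y : ℝ, ∃ c, PC M c ∧ ∑ i ∈ Finset.range M, c i * a i = x ∧
    ∑ i ∈ Finset.range M, c i * b i = y) ∧
  (∀ c c', PC M c → PC M c' →
    ∑ i ∈ Finset.range M, c i * a i = ∑ i ∈ Finset.range M, c' i * a i →
    ∑ i ∈ Finset.range M, c i * b i = ∑ i ∈ Finset.range M, c' i * b i → c = c')

lemma planar_three : Planar 3 (fun i => if i = 0 then 1 else if i = 1 then 0 else -1)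
    (fun i => if i = 0 then 0 else if i = 1 then 1 else -1) := by
  refine ⟨?_, ?_, ?_⟩
  · intro i hi
    interval_cases i <;> simp [nx]
  · intro x y
    obtain ⟨t, h0, h1, h2, h3⟩ : ∃ t : ℝ, 0 ≤ t ∧ 0 ≤ x + t ∧ 0 ≤ y + t ∧
        (t = 0 ∨ x + t = 0 ∨ y + t = 0) := by
      rcases le_total 0 x with hx | hx <;> rcases le_total 0 y with hy | hy <;>
        rcases le_total x y with hxy | hxy
      all_goals first
        | exact ⟨0, by linarith, by linarith, by linarith, Or.inl rfl⟩
        | exact ⟨-x, by linarith, by linarith, by linarith, Or.inr (Or.inl (by ring))⟩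
        | exact ⟨-y, by linarith, by linarith, by linarith, Or.inr (Or.inr (by ring))⟩
    refine ⟨fun i => if i = 0 then x + t else if i = 1 then y + t else if i = 2 then t else 0,
      ⟨?_, ?_⟩, ?_, ?_⟩
    · intro i
      dsimp only
      split_ifs <;> linarith
    · rcases h3 with h | h | h
      · exact ⟨0, by norm_num, fun j h1 h2 => by simp [nx] at h2; simp [h1, h2, h]⟩
      · exact ⟨1, by norm_num, fun j h1 h2 => by simp [nx] at h2; simp [h1, h2, h]⟩
      · exact ⟨2, by norm_num, fun j h1 h2 => by simp [nx] at h2; simp [h1, h2, h]⟩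
    · simp [Finset.sum_range_succ]
    · simp [Finset.sum_range_succ]
  · intro c c' hc hc' h1 h2
    have key : ∀ c, PC 3 c → (c 0 = 0 ∨ c 1 = 0 ∨ c 2 = 0) ∧ ∀ j, 3 ≤ j → c j = 0 := by
      rintro c ⟨h0, i, hi, h⟩
      refine ⟨?_, fun j hj => h j (by omega) (by unfold nx; split_ifs <;> omega)⟩
      interval_cases i
      · exact Or.inr (Or.inr (h 2 (by norm_num) (by simp [nx])))
      · exact Or.inl (h 0 (by norm_num) (by simp [nx]))
      · exact Or.inr (Or.inl (h 1 (by norm_num) (by simp [nx])))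
    obtain ⟨k1, k2⟩ := key c hc
    obtain ⟨k1', k2'⟩ := key c' hc'
    simp [Finset.sum_range_succ] at h1 h2
    have p0 := hc.1 0
    have p1 := hc.1 1
    have p2 := hc.1 2
    have p0' := hc'.1 0
    have p1' := hc'.1 1
    have p2' := hc'.1 2
    have e2 : c 2 = c' 2 := by
      rcases k1 with k | k | k <;> rcases k1' with k' | k' | k' <;> linarith
    funext j
    by_cases hj : 3 ≤ j
    · rw [k2 j hj, k2' j hj]
    · interval_cases j
      · linarith
      · linarith
      · exact e2

/-- undo the subdivision of the last edge -/
def lft (m : ℕ) (c : ℕ → ℝ) (i : ℕ) : ℝ :=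
  if i = m + 1 then 0 else if i = 0 ∨ i = m then c i + c (m+1) else c i

lemma sum_lft {m : ℕ} (hm : 2 ≤ m) (c a : ℕ → ℝ) :
    ∑ i ∈ Finset.range (m+1), lft m c i * a i =
      ∑ i ∈ Finset.range (m+2), c i * (if i = m + 1 then a m + a 0 else a i) := by
  obtain ⟨k, rfl⟩ : ∃ k, m = k + 1 := ⟨m - 1, by omega⟩
  have e1 : ∑ i ∈ Finset.range k, lft (k+1) c (i+1) * a (i+1) =
      ∑ i ∈ Finset.range k, c (i+1) * a (i+1) := by
    refine Finset.sum_congr rfl fun i hi => ?_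
    have := Finset.mem_range.mp hi
    unfold lft
    rw [if_neg (by omega), if_neg (by omega)]
  have e2 : ∑ i ∈ Finset.range k, c (i+1) * (if i + 1 = k + 1 + 1 then a (k+1) + a 0 else a (i+1)) =
      ∑ i ∈ Finset.range k, c (i+1) * a (i+1) := by
    refine Finset.sum_congr rfl fun i hi => ?_
    have := Finset.mem_range.mp hi
    rw [if_neg (by omega)]
  rw [Finset.sum_range_succ, Finset.sum_range_succ', e1, Finset.sum_range_succ,
    Finset.sum_range_succ, Finset.sum_range_succ', e2]
  simp [lft]
  ring

lemma planar_step {m : ℕ} (hm : 2 ≤ m) {a b : ℕ → ℝ} (h : Planar (m+1) a b) :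
    Planar (m+2) (fun i => if i = m + 1 then a m + a 0 else a i)
      (fun i => if i = m + 1 then b m + b 0 else b i) := by
  obtain ⟨hpos, hex, huniq⟩ := h
  refine ⟨?_, ?_, ?_⟩
  · intro i hi
    rcases Nat.lt_or_ge i m with h | h
    · have := hpos i (by omega)
      simp only [nx] at this ⊢
      rw [if_neg (by omega)] at this
      simp only [show ¬ i + 1 = m + 2 by omega, show ¬ i = m + 1 by omega,
        show ¬ i + 1 = m + 1 by omega, if_false]
      exact this
    · have := hpos m (by omega)
      simp only [nx, if_true] at this
      rcases (show i = m ∨ i = m + 1 by omega) with rfl | rfl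
      · simp [nx]; linarith
      · simp [nx]; linarith
  · intro x y
    obtain ⟨d, ⟨hd0, i, hi, hdi⟩, hx, hy⟩ := hex x y
    have hd1 : d (m+1) = 0 := hdi _ (by omega) (by unfold nx; split_ifs <;> omega)
    set μ := min (d 0) (d m) with hμ
    have hμ0 : 0 ≤ μ := le_min (hd0 _) (hd0 _)
    have hμa : μ ≤ d 0 := min_le_left _ _
    have hμb : μ ≤ d m := min_le_right _ _
    let c : ℕ → ℝ := fun i => if i = m + 1 then μ else if i = 0 ∨ i = m then d i - μ else d i
    have hl : lft m c = d := by
      funext j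
      simp only [lft, c]
      split_ifs with h1 h2
      · rw [h1, hd1]
      · simp
      · rfl
    refine ⟨c, ⟨?_, ?_⟩, ?_, ?_⟩
    · intro j
      simp only [c]
      split_ifs with h1 h2
      · exact hμ0
      · rcases h2 with h2 | h2 <;> rw [h2] <;> linarith
      · exact hd0 j
    · rcases Nat.lt_or_ge i m with him | him
      · have hμz : μ = 0 := by
          have : d 0 = 0 ∨ d m = 0 := by
            by_cases h0 : i = 0
            · right; exact hdi m (by omega) (by unfold nx; split_ifs <;> omega)
            · left; exact hdi 0 (by omega) (by unfold nx; split_ifs <;> omega)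
          rcases this with h | h <;> linarith
        refine ⟨i, by omega, fun j h1 h2 => ?_⟩
        have hj := hdi j h1 (by unfold nx at h2 ⊢; rw [if_neg (by omega)] at h2 ⊢; exact h2)
        simp only [c, hμz, hj]
        split_ifs <;> simp
      · have him : i = m := by omega
        subst him
        have hdj : ∀ j, j ≠ i → j ≠ 0 → d j = 0 := fun j h1 h2 => hdi j h1 (by simpa [nx] using h2)
        rcases le_total (d 0) (d i) with hle | hle
        · have hμe : μ = d 0 := min_eq_left hle
          refine ⟨i, by omega, fun j h1 h2 => ?_⟩
          simp [nx] at h2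
          simp only [c, if_neg h2]
          split_ifs with h3
          · rcases h3 with h3 | h3
            · rw [h3, hμe]; ring
            · exact absurd h3 h1
          · exact hdj j h1 (by tauto)
        · have hμe : μ = d i := min_eq_right hle
          refine ⟨i+1, by omega, fun j h1 h2 => ?_⟩
          simp [nx] at h2
          simp only [c, if_neg h1]
          split_ifs with h3
          · rcases h3 with h3 | h3
            · exact absurd h3 h2
            · rw [h3, hμe]; ring
          · exact hdj j (by tauto) h2
    · rw [← sum_lft hm, hl, hx]
    · rw [← sum_lft hm, hl, hy]
  · intro c c' hc hc' h1 h2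
    rw [← sum_lft hm, ← sum_lft hm] at h1 h2
    have key : ∀ c, PC (m+2) c → PC (m+1) (lft m c) ∧ c (m+1) = min (lft m c 0) (lft m c m) := by
      rintro c ⟨h0, i, hi, h⟩
      refine ⟨⟨fun j => ?_, ?_⟩, ?_⟩
      · unfold lft
        split_ifs
        · exact le_rfl
        · exact add_nonneg (h0 _) (h0 _)
        · exact h0 _
      · rcases Nat.lt_or_ge i m with him | him
        · have hz : c (m+1) = 0 := h _ (by omega) (by unfold nx; split_ifs <;> omega)
          refine ⟨i, by omega, fun j h1 h2 => ?_⟩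
          have hj := h j h1 (by unfold nx at h2 ⊢; rw [if_neg (by omega)] at h2 ⊢; exact h2)
          unfold lft
          rw [hz, hj]; simp
        · refine ⟨m, by omega, fun j h1 h2 => ?_⟩
          simp [nx] at h2
          unfold lft
          split_ifs with h3 h4
          · rfl
          · tauto
          · refine h j ?_ ?_
            · omega
            · unfold nx; split_ifs <;> omega
      · have hor : c 0 = 0 ∨ c m = 0 := by
          by_cases h1 : i = 0
          · right; exact h m (by omega) (by unfold nx; split_ifs <;> omega)
          · by_cases h2 : i = m + 1
            · right; exact h m (by omega) (by unfold nx; split_ifs <;> omega)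
            · left; exact h 0 (by omega) (by unfold nx; split_ifs <;> omega)
        simp only [lft, true_or, or_true, if_true, show ¬ 0 = m + 1 by omega, show ¬ m = m + 1 by omega,
          if_false]
        rcases hor with h | h
        · rw [h, min_eq_left]
          · ring
          · linarith [h0 m]
        · rw [h, min_eq_right]
          · ring
          · linarith [h0 0]
    obtain ⟨k1, k2⟩ := key c hc
    obtain ⟨k1', k2'⟩ := key c' hc'
    have e := huniq _ _ k1 k1' h1 h2
    have e2 : c (m+1) = c' (m+1) := by rw [k2, k2', e]
    funext j
    have ej := congrFun e j
    unfold lft at ej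
    split_ifs at ej with h3 h4
    · rw [h3, e2]
    · linarith
    · exact ej

lemma exists_planar {M : ℕ} (hM : 3 ≤ M) : ∃ a b, Planar M a b := by
  induction M, hM using Nat.le_induction with
  | base => exact ⟨_, _, planar_three⟩
  | succ M hM ih =>
    obtain ⟨a, b, h⟩ := ih
    obtain ⟨m, rfl⟩ : ∃ m, M = m + 1 := ⟨M - 1, by omega⟩
    exact ⟨_, _, planar_step (by omega) h⟩

/-- cyclic successor on `Fin M` -/
def nxt {M : ℕ} (i : Fin M) : Fin M := ⟨nx M i, by have := i.2; unfold nx; split_ifs <;> omega⟩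

/-- coefficient vectors supported on an edge of the cycle -/
def PF {M : ℕ} (c : Fin M → ℝ) : Prop :=
  (∀ i, 0 ≤ c i) ∧ ∃ i, ∀ j, j ≠ i → j ≠ nxt i → c j = 0

lemma exists_planarFin {M : ℕ} (hM : 3 ≤ M) : ∃ a b : Fin M → ℝ,
    (∀ i, 0 < a i * b (nxt i) - a (nxt i) * b i) ∧
    (∀ x y : ℝ, ∃ c, PF c ∧ ∑ i, c i * a i = x ∧ ∑ i, c i * b i = y) ∧
    (∀ c c' : Fin M → ℝ, PF c → PF c' → ∑ i, c i * a i = ∑ i, c' i * a i →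
      ∑ i, c i * b i = ∑ i, c' i * b i → c = c') := by
  obtain ⟨a, b, h1, h2, h3⟩ := exists_planar hM
  refine ⟨fun i => a i, fun i => b i, fun i => h1 i i.2, ?_, ?_⟩
  · intro x y
    obtain ⟨c, ⟨h0, i, hi, hc⟩, hx, hy⟩ := h2 x y
    refine ⟨fun i => c i, ⟨fun i => h0 i, ⟨i, hi⟩, fun j hj1 hj2 => hc j ?_ ?_⟩, ?_, ?_⟩
    · intro h; exact hj1 (Fin.ext h)
    · intro h; exact hj2 (Fin.ext h)
    · rw [← hx, Finset.sum_range]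
    · rw [← hy, Finset.sum_range]
  · intro c c' hc hc' hx hy
    let ex : (Fin M → ℝ) → ℕ → ℝ := fun c i => if h : i < M then c ⟨i, h⟩ else 0
    have hex : ∀ c, PF c → PC M (ex c) := by
      rintro c ⟨h0, i, hi⟩
      refine ⟨fun j => ?_, i, i.2, fun j hj1 hj2 => ?_⟩
      · simp only [ex]; split_ifs
        · exact h0 _
        · exact le_rfl
      · simp only [ex]; split_ifs with hj
        · refine hi _ ?_ ?_
          · intro h; exact hj1 (congrArg Fin.val h)
          · intro h; exact hj2 (congrArg Fin.val h)
        · rfl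
    have hs : ∀ (c : Fin M → ℝ) (a : ℕ → ℝ), ∑ i ∈ Finset.range M, ex c i * a i = ∑ i, c i * a i := by
      intro c a
      rw [Finset.sum_range]
      exact Finset.sum_congr rfl fun i _ => by simp [ex]
    have := h3 (ex c) (ex c') (hex c hc) (hex c' hc') (by rw [hs, hs, hx]) (by rw [hs, hs, hy])
    funext i
    have := congrFun this i
    simpa [ex] using this

end Stmt8

namespace Stmt8

section
variable {M : ℕ}

lemma nxt_ne (hM : 3 ≤ M) (j : Fin M) : nxt j ≠ j := by
  have := j.2
  intro h
  have h := congrArg Fin.val h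
  simp only [nxt, nx] at h
  split_ifs at h <;> omega

lemma nxt_nxt_ne (hM : 3 ≤ M) (j : Fin M) : nxt (nxt j) ≠ j := by
  have := j.2
  intro h
  have h := congrArg Fin.val h
  simp only [nxt, nx] at h
  split_ifs at h <;> omega

lemma nxt_inj {i j : Fin M} (h : nxt i = nxt j) : i = j := by
  have := j.2
  have := i.2
  have h := congrArg Fin.val h
  simp only [nxt, nx] at h
  apply Fin.ext
  split_ifs at h <;> omega

lemma nxt_mod (h3 : 3 ∣ M) (j : Fin M) : (nxt j).val % 3 = (j.val + 1) % 3 := by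
  have := j.2
  simp only [nxt, nx]
  split_ifs <;> omega

/-- coefficient vectors on the base complex -/
def BC (cR cm : Fin M → ℝ) (cN cS : ℝ) : Prop :=
  (∀ i, 0 ≤ cR i) ∧ (∀ i, 0 ≤ cm i) ∧ 0 ≤ cN ∧ 0 ≤ cS ∧
    ∃ j, (∀ i, i ≠ j → i ≠ nxt j → cR i = 0) ∧ (∀ i, i ≠ j → cm i = 0) ∧
      ((cm j = 0 ∧ cN = 0) ∨ (cS = 0 ∧ (cN = 0 ∨ cR (nxt j) = 0 ∨ cR j = 0)))

/-- planar shadow of a coefficient vector -/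
def shd (cR cm : Fin M → ℝ) (i : Fin M) : ℝ :=
  cR i + cm i + ∑ j, if nxt j = i then cm j else 0

lemma sum_shd (cR cm a : Fin M → ℝ) :
    ∑ i, shd cR cm i * a i = ∑ i, cR i * a i + ∑ i, cm i * (a i + a (nxt i)) := by
  simp only [shd, add_mul, mul_add, Finset.sum_add_distrib, Finset.sum_mul]
  rw [Finset.sum_comm (f := fun i j => (if nxt j = i then cm j else 0) * a i)]
  simp only [ite_mul, zero_mul, Finset.sum_ite_eq, Finset.mem_univ, if_true]
  ring

lemma BC.key (hM : 3 ≤ M) {cR cm : Fin M → ℝ} {cN cS : ℝ} (h : BC cR cm cN cS) :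
    PF (shd cR cm) ∧
    (∀ i, cm i = max 0 (min (min (shd cR cm i) (shd cR cm (nxt i))) (∑ i, cm i + cN - cS))) ∧
    (cN = 0 ∨ cS = 0) := by
  obtain ⟨h1, h2, h3, h4, j, h5, h6, h7⟩ := h
  have hs : ∑ i, cm i = cm j := Fintype.sum_eq_single j fun i hi => h6 i hi
  have hL : ∀ i, shd cR cm i = cR i + cm i + if nxt j = i then cm j else 0 := by
    intro i
    unfold shd
    congr 1
    refine Fintype.sum_eq_single j fun i hi => ?_
    simp [h6 i hi]
  have L0 : ∀ i, i ≠ j → i ≠ nxt j → shd cR cm i = 0 := by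
    intro i h h'
    rw [hL, h5 i h h', h6 i h, if_neg h'.symm]; simp
  have L1 : shd cR cm j = cR j + cm j := by
    rw [hL, if_neg (nxt_ne hM j)]; simp
  have L2 : shd cR cm (nxt j) = cR (nxt j) + cm j := by
    rw [hL, if_pos rfl, h6 _ (nxt_ne hM j)]; simp
  have Lp : ∀ i, 0 ≤ shd cR cm i := by
    intro i
    rw [hL]
    have := h1 i
    have := h2 i
    have := h2 j
    split_ifs <;> linarith
  refine ⟨⟨Lp, j, L0⟩, ?_, by tauto⟩
  intro i
  by_cases hi : i = j
  · subst hi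
    rw [L1, L2, hs]
    have a1 := h1 i
    have a2 := h1 (nxt i)
    have a3 := h2 i
    rcases h7 with ⟨e1, e2⟩ | ⟨e1, e2 | e2 | e2⟩
    · rw [max_eq_left]
      · exact e1
      · exact (min_le_right _ _).trans (by linarith)
    · rw [min_eq_right (le_min (by linarith) (by linarith)), max_eq_right (by linarith)]
      linarith
    · rw [min_eq_right (a := cR i + cm i) (by linarith), min_eq_left (by linarith),
        max_eq_right (by linarith)]
      linarith
    · rw [min_eq_left (a := cR i + cm i) (by linarith), min_eq_left (by linarith),
        max_eq_right (by linarith)]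
      linarith
  · rw [h6 i hi, max_eq_left]
    refine (min_le_left _ _).trans ?_
    by_cases hi' : i = nxt j
    · refine (min_le_right _ _).trans (L0 _ ?_ ?_).le
      · rw [hi']; exact nxt_nxt_ne hM j
      · intro hh; exact hi (nxt_inj hh)
    · exact (min_le_left _ _).trans (L0 _ hi hi').le

/-- The vertices of the base sphere. -/
abbrev BV (M : ℕ) : Type := (Fin M ⊕ Fin M) ⊕ Bool

/-- rim vertices -/
def vR (j : Fin M) : BV M := Sum.inl (Sum.inl j)
/-- middle vertices -/
def vm (j : Fin M) : BV M := Sum.inl (Sum.inr j)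
/-- north pole -/
def vN : BV M := Sum.inr true
/-- south pole -/
def vS : BV M := Sum.inr false

/-- base complex -/
def bcx (M : ℕ) : AbsCx (BV M) where
  faces := {s | s.Nonempty ∧ ∃ j : Fin M, (∀ v ∈ s, v = vS ∨ v = vR j ∨ v = vR (nxt j)) ∨
    (∀ v ∈ s, v = vm j ∨ v = vR j ∨ v = vR (nxt j)) ∨
    (∀ v ∈ s, v = vm j ∨ v = vR j ∨ v = vN) ∨
    (∀ v ∈ s, v = vm j ∨ v = vR (nxt j) ∨ v = vN)}
  down_closed := by
    rintro s t ⟨hs, j, h⟩ hts ht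
    refine ⟨ht, j, ?_⟩
    rcases h with h | h | h | h
    · exact Or.inl fun v hv => h v (hts hv)
    · exact Or.inr (Or.inl fun v hv => h v (hts hv))
    · exact Or.inr (Or.inr (Or.inl fun v hv => h v (hts hv)))
    · exact Or.inr (Or.inr (Or.inr fun v hv => h v (hts hv)))
  nonempty_of_mem := fun _ h => h.1

/-- base vectors -/
def bvec (a b : Fin M → ℝ) : BV M → Fin 3 → ℝ
  | Sum.inl (Sum.inl j) => ![a j, b j, 0]
  | Sum.inl (Sum.inr j) => ![a j + a (nxt j), b j + b (nxt j), 1]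
  | Sum.inr true => ![0, 0, 1]
  | Sum.inr false => ![0, 0, -1]

lemma forall_BV {P : BV M → Prop} : (∀ v, P v) ↔
    (∀ j, P (vR j)) ∧ (∀ j, P (vm j)) ∧ P vN ∧ P vS := by
  constructor
  · intro h; exact ⟨fun j => h _, fun j => h _, h _, h _⟩
  · rintro ⟨h1, h2, h3, h4⟩ ((j | j) | (_ | _))
    · exact h1 j
    · exact h2 j
    · exact h4
    · exact h3

lemma isC_bcx (hM : 3 ≤ M) {c : BV M → ℝ} : IsC (bcx M) c ↔
    BC (fun j => c (vR j)) (fun j => c (vm j)) (c vN) (c vS) := by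
  constructor
  · rintro ⟨h0, s, ⟨hs, j, h⟩, hz⟩
    refine ⟨fun j => h0 _, fun j => h0 _, h0 _, h0 _, j, ?_⟩
    have Z : ∀ v, (∀ w ∈ s, w ≠ v) → c v = 0 := fun v hv => hz v fun hh => hv v hh rfl
    have hn := nxt_ne hM j
    rcases h with h | h | h | h
    · refine ⟨fun i hi hi' => Z _ fun w hw => ?_, fun i hi => Z _ fun w hw => ?_,
        Or.inl ⟨Z _ fun w hw => ?_, Z _ fun w hw => ?_⟩⟩ <;>
      rcases h w hw with rfl | rfl | rfl <;> simp [vR, vm, vN, vS, Ne.symm, *] <;>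
        simp [eq_comm, *]
    · refine ⟨fun i hi hi' => Z _ fun w hw => ?_, fun i hi => Z _ fun w hw => ?_,
        Or.inr ⟨Z _ fun w hw => ?_, Or.inl (Z _ fun w hw => ?_)⟩⟩ <;>
      rcases h w hw with rfl | rfl | rfl <;> simp [vR, vm, vN, vS, Ne.symm, *] <;>
        simp [eq_comm, *]
    · refine ⟨fun i hi hi' => Z _ fun w hw => ?_, fun i hi => Z _ fun w hw => ?_,
        Or.inr ⟨Z _ fun w hw => ?_, Or.inr (Or.inl (Z _ fun w hw => ?_))⟩⟩ <;>
      rcases h w hw with rfl | rfl | rfl <;> simp [vR, vm, vN, vS, Ne.symm, *] <;>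
        simp [eq_comm, *]
    · refine ⟨fun i hi hi' => Z _ fun w hw => ?_, fun i hi => Z _ fun w hw => ?_,
        Or.inr ⟨Z _ fun w hw => ?_, Or.inr (Or.inr (Z _ fun w hw => ?_))⟩⟩ <;>
      rcases h w hw with rfl | rfl | rfl <;> simp [vR, vm, vN, vS, Ne.symm, *] <;>
        simp [eq_comm, *]
  · rintro ⟨h1, h2, h3, h4, j, h5, h6, h7⟩
    refine ⟨forall_BV.2 ⟨h1, h2, h3, h4⟩, ?_⟩
    rcases h7 with ⟨e1, e2⟩ | ⟨e1, e2 | e2 | e2⟩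
    · refine ⟨{vS, vR j, vR (nxt j)}, ⟨by simp, j, Or.inl fun v hv => by simpa using hv⟩, ?_⟩
      refine forall_BV.2 ⟨fun i hi => h5 i ?_ ?_, fun i hi => ?_, fun _ => e2, fun h => by simp at h⟩
      · rintro rfl; simp at hi
      · rintro rfl; simp at hi
      · by_cases hij : i = j
        · rw [hij]; exact e1
        · exact h6 i hij
    · refine ⟨{vm j, vR j, vR (nxt j)},
        ⟨by simp, j, Or.inr (Or.inl fun v hv => by simpa using hv)⟩, ?_⟩
      refine forall_BV.2 ⟨fun i hi => h5 i ?_ ?_, fun i hi => h6 i ?_, fun _ => e2, fun _ => e1⟩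
      · rintro rfl; simp at hi
      · rintro rfl; simp at hi
      · rintro rfl; simp at hi
    · refine ⟨{vm j, vR j, vN},
        ⟨by simp, j, Or.inr (Or.inr (Or.inl fun v hv => by simpa using hv))⟩, ?_⟩
      refine forall_BV.2 ⟨fun i hi => ?_, fun i hi => h6 i ?_, fun h => by simp at h, fun _ => e1⟩
      · by_cases hij : i = nxt j
        · rw [hij]; exact e2
        · refine h5 i ?_ hij
          rintro rfl; simp at hi
      · rintro rfl; simp at hi
    · refine ⟨{vm j, vR (nxt j), vN},
        ⟨by simp, j, Or.inr (Or.inr (Or.inr fun v hv => by simpa using hv))⟩, ?_⟩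
      refine forall_BV.2 ⟨fun i hi => ?_, fun i hi => h6 i ?_, fun h => by simp at h, fun _ => e1⟩
      · by_cases hij : i = j
        · rw [hij]; exact e2
        · refine h5 i hij ?_
          rintro rfl; simp at hi
      · rintro rfl; simp at hi

lemma sum_bvec (a b : Fin M → ℝ) (c : BV M → ℝ) : ∑ v, c v • bvec a b v =
    ![∑ i, shd (fun j => c (vR j)) (fun j => c (vm j)) i * a i,
      ∑ i, shd (fun j => c (vR j)) (fun j => c (vm j)) i * b i,
      ∑ i, c (vm i) + c vN - c vS] := by
  rw [sum_shd, sum_shd]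
  funext k
  fin_cases k <;>
    simp [Fintype.sum_sum_type, bvec, vR, vm, vN, vS] <;> ring

lemma bfan (hM : 3 ≤ M) {a b : Fin M → ℝ}
    (hex : ∀ x y, ∃ c, PF c ∧ ∑ i, c i * a i = x ∧ ∑ i, c i * b i = y)
    (hun : ∀ c c', PF c → PF c' → ∑ i, c i * a i = ∑ i, c' i * a i →
      ∑ i, c i * b i = ∑ i, c' i * b i → c = c') : IsFan (bcx M) (bvec a b) := by
  refine ⟨?_, ?_⟩
  · intro x
    obtain ⟨c, ⟨hc0, j, hcj⟩, hx, hy⟩ := hex (x 0) (x 1)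
    have hn := nxt_ne hM j
    obtain ⟨μ, ν, σ, p1, p2, p3, p4, p5, p6, p7⟩ : ∃ μ ν σ : ℝ, 0 ≤ μ ∧ 0 ≤ ν ∧ 0 ≤ σ ∧
        μ ≤ c j ∧ μ ≤ c (nxt j) ∧ μ + ν - σ = x 2 ∧
        ((μ = 0 ∧ ν = 0) ∨ (σ = 0 ∧ (ν = 0 ∨ c (nxt j) - μ = 0 ∨ c j - μ = 0))) := by
      rcases le_total (x 2) 0 with h | h
      · exact ⟨0, 0, - x 2, le_rfl, le_rfl, by linarith, hc0 _, hc0 _, by ring, Or.inl ⟨rfl, rfl⟩⟩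
      · have q1 := hc0 j
        have q2 := hc0 (nxt j)
        rcases le_total (c j) (c (nxt j)) with h1 | h1
        · rcases le_total (c j) (x 2) with h2 | h2
          · exact ⟨c j, x 2 - c j, 0, by linarith, by linarith, le_rfl, le_rfl, h1, by ring,
              Or.inr ⟨rfl, Or.inr (Or.inr (by ring))⟩⟩
          · exact ⟨x 2, 0, 0, h, le_rfl, le_rfl, h2, by linarith, by ring, Or.inr ⟨rfl, Or.inl rfl⟩⟩
        · rcases le_total (c (nxt j)) (x 2) with h2 | h2
          · exact ⟨c (nxt j), x 2 - c (nxt j), 0, by linarith, by linarith, le_rfl, h1, le_rfl,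
              by ring, Or.inr ⟨rfl, Or.inr (Or.inl (by ring))⟩⟩
          · exact ⟨x 2, 0, 0, h, le_rfl, le_rfl, by linarith, h2, by ring, Or.inr ⟨rfl, Or.inl rfl⟩⟩
    let cR : Fin M → ℝ := fun i => c i - (if i = j then μ else 0) - (if i = nxt j then μ else 0)
    let cm : Fin M → ℝ := fun i => if i = j then μ else 0
    let C : BV M → ℝ := Sum.elim (Sum.elim cR cm) (fun t => if t then ν else σ)
    have eR : (fun j => C (vR j)) = cR := rfl
    have em : (fun j => C (vm j)) = cm := rfl
    have eN : C vN = ν := rfl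
    have eS : C vS = σ := rfl
    have eL : shd cR cm = c := by
      funext i
      have : (∑ k, if nxt k = i then cm k else 0) = if i = nxt j then μ else 0 := by
        rw [Fintype.sum_eq_single j fun k hk => by simp [cm, hk]]
        simp [cm, eq_comm]
      rw [shd, this]
      simp only [cR, cm]
      ring
    refine ⟨C, ?_, ?_⟩
    · rw [isC_bcx hM, eR, em, eN, eS]
      refine ⟨?_, ?_, p2, p3, j, ?_, ?_, ?_⟩
      · intro i
        simp only [cR]
        by_cases h1 : i = j
        · subst h1; rw [if_pos rfl, if_neg hn.symm]; linarith
        · by_cases h2 : i = nxt j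
          · subst h2; rw [if_neg h1, if_pos rfl]; linarith
          · rw [if_neg h1, if_neg h2]; have := hc0 i; linarith
      · intro i
        simp only [cm]
        split_ifs
        · exact p1
        · exact le_rfl
      · intro i h1 h2
        simp [cR, h1, h2, hcj i h1 h2]
      · intro i h1
        simp [cm, h1]
      · simpa [cR, cm, hn, hn.symm] using p7
    · rw [sum_bvec, eR, em, eL, hx, hy, eN, eS]
      have : ∑ i, cm i = μ := by simp [cm]
      rw [this, p6]
      funext k
      fin_cases k <;> rfl
  · intro c c' hc hc' h
    rw [isC_bcx hM] at hc hc'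
    rw [sum_bvec, sum_bvec] at h
    have g0 := congrFun h 0
    have g1 := congrFun h 1
    have g2 := congrFun h 2
    simp only [Matrix.cons_val] at g0 g1 g2
    obtain ⟨k1, k2, k3⟩ := hc.key hM
    obtain ⟨k1', k2', k3'⟩ := hc'.key hM
    have hL := hun _ _ k1 k1' g0 g1
    have hm : (fun j => c (vm j)) = fun j => c' (vm j) := by
      funext i
      rw [k2 i, k2' i, hL, g2]
    have hm' : ∀ j, c (vm j) = c' (vm j) := fun j => congrFun hm j
    have hR : ∀ j, c (vR j) = c' (vR j) := by
      intro i
      have := congrFun hL i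
      simp only [shd, hm'] at this
      linarith
    simp only [hm'] at g2
    have q1 := hc.2.2.1
    have q2 := hc.2.2.2.1
    have q3 := hc'.2.2.1
    have q4 := hc'.2.2.2.1
    have : c vN = c' vN ∧ c vS = c' vS := by
      rcases k3 with e | e <;> rcases k3' with e' | e' <;> constructor <;> linarith
    exact funext (forall_BV.2 ⟨hR, hm', this.1, this.2⟩)

/-- colours -/
def col : BV M → Fin 4
  | Sum.inl (Sum.inl j) => ⟨j.val % 3, by omega⟩
  | Sum.inl (Sum.inr j) => ⟨(j.val + 2) % 3, by omega⟩
  | Sum.inr _ => 3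

/-- the ordered facets over the chosen target facet -/
def fac (j : Fin M) : Fin 3 → BV M :=
  if j.val % 3 = 0 then ![vR j, vR (nxt j), vm j]
  else if j.val % 3 = 1 then ![vm j, vR j, vR (nxt j)]
  else ![vR (nxt j), vm j, vR j]

lemma col_R (j : Fin M) : (col (vR j)).val = j.val % 3 := rfl
lemma col_m (j : Fin M) : (col (vm j)).val = (j.val + 2) % 3 := rfl
lemma col_N : (col (vN : BV M)).val = 3 := rfl
lemma col_S : (col (vS : BV M)).val = 3 := rfl

lemma fac_inj {i j : Fin M} (h : fac i = fac j) : i = j := by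
  have h0 := congrFun h 0
  have h1 := congrFun h 1
  have h2 := congrFun h 2
  unfold fac at h0 h1 h2
  split_ifs at h0 h1 h2 <;> simp [vR, vm] at h0 h1 h2 <;> tauto

lemma fac_face (j : Fin M) : Finset.image (fac j) Finset.univ ∈ (bcx M).faces := by
  refine ⟨by simp, j, Or.inr (Or.inl ?_)⟩
  simp only [Finset.mem_image, Finset.mem_univ, true_and, forall_exists_index,
    forall_apply_eq_imp_iff]
  intro k
  unfold fac
  split_ifs <;> fin_cases k <;> simp

lemma fac_col (h3 : 3 ∣ M) (j : Fin M) (k : Fin 3) : (col (fac j k)).val = k.val := by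
  have h := nxt_mod h3 j
  have : j.val % 3 < 3 := Nat.mod_lt _ (by norm_num)
  unfold fac
  split_ifs <;> fin_cases k <;> simp [col_R, col_m] <;> omega

lemma fac_dt (a b : Fin M → ℝ) (j : Fin M) :
    dt (n := 2) (bvec a b) (fac j) = a j * b (nxt j) - a (nxt j) * b j := by
  unfold dt fac
  split_ifs <;> simp [Matrix.det_fin_three, bvec, vR, vm] <;> ring

lemma fac_of (h3 : 3 ∣ M) {x : Fin 3 → BV M}
    (hx : Finset.image x Finset.univ ∈ (bcx M).faces)
    (hc : ∀ k, (col (x k)).val = k.val) : ∃ j, x = fac j := by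
  obtain ⟨-, j, h⟩ := hx
  simp only [Finset.mem_image, Finset.mem_univ, true_and, forall_exists_index,
    forall_apply_eq_imp_iff] at h
  refine ⟨j, ?_⟩
  have hm := nxt_mod h3 j
  have h012 : ∀ k, (col (x k)).val = k.val := hc
  have c0 := hc 0
  have c1 := hc 1
  have c2 := hc 2
  rcases h with h | h | h | h
  · exfalso
    rcases h 0 with e0 | e0 | e0 <;> rcases h 1 with e1 | e1 | e1 <;>
      rcases h 2 with e2 | e2 | e2 <;> rw [e0] at c0 <;> rw [e1] at c1 <;> rw [e2] at c2 <;>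
      simp [col_R, col_m, col_N, col_S] at c0 c1 c2 <;> omega
  · funext k
    have ck := hc k
    have fk := fac_col h3 j k
    have hf : fac j k = vm j ∨ fac j k = vR j ∨ fac j k = vR (nxt j) := by
      unfold fac
      split_ifs <;> fin_cases k <;> simp
    rcases h k with e | e | e <;> rcases hf with e' | e' | e' <;> rw [e] at ck ⊢ <;>
      rw [e'] at fk ⊢ <;> simp only [col_R, col_m] at ck fk <;> omega
  · exfalso
    rcases h 0 with e0 | e0 | e0 <;> rcases h 1 with e1 | e1 | e1 <;>
      rcases h 2 with e2 | e2 | e2 <;> rw [e0] at c0 <;> rw [e1] at c1 <;> rw [e2] at c2 <;>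
      simp [col_R, col_m, col_N, col_S] at c0 c1 c2 <;> omega
  · exfalso
    rcases h 0 with e0 | e0 | e0 <;> rcases h 1 with e1 | e1 | e1 <;>
      rcases h 2 with e2 | e2 | e2 <;> rw [e0] at c0 <;> rw [e1] at c1 <;> rw [e2] at c2 <;>
      simp [col_R, col_m, col_N, col_S] at c0 c1 c2 <;> omega

lemma good_base (hM : 3 ≤ M) (h3 : 3 ∣ M) : Good (BV M) 2 (M : ℤ) := by
  obtain ⟨a, b, hpos, hex, hun⟩ := exists_planarFin hM
  refine ⟨bcx M, bvec a b, col, Fin.castSucc, ?_, bfan hM hex hun, ?_,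
    Fin.castSucc_injective _, ?_⟩
  · rw [Set.eq_univ_iff_forall, forall_BV]
    refine ⟨fun j => ⟨by simp, j, ?_⟩, fun j => ⟨by simp, j, ?_⟩,
      ⟨by simp, ⟨0, by omega⟩, ?_⟩, ⟨by simp, ⟨0, by omega⟩, ?_⟩⟩ <;> simp
  · rintro s ⟨hs, j, h⟩
    refine ⟨hs.image _, fun hu => ?_⟩
    have hle : s.card ≤ 3 := by
      rcases h with h | h | h | h
      · exact (Finset.card_le_card (t := {vS, vR j, vR (nxt j)})
          fun v hv => by simpa using h v hv).trans Finset.card_le_three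
      · exact (Finset.card_le_card (t := {vm j, vR j, vR (nxt j)})
          fun v hv => by simpa using h v hv).trans Finset.card_le_three
      · exact (Finset.card_le_card (t := {vm j, vR j, vN})
          fun v hv => by simpa using h v hv).trans Finset.card_le_three
      · exact (Finset.card_le_card (t := {vm j, vR (nxt j), vN})
          fun v hv => by simpa using h v hv).trans Finset.card_le_three
    have h2 : (s.image col).card ≤ s.card := Finset.card_image_le
    rw [hu] at h2
    simp at h2
    omega
  · rw [algSum_eq]
    have h1 : ∑ x ∈ Finset.univ.image (fac : Fin M → Fin 3 → BV M),
        (if col ∘ x = Fin.castSucc then sgn (n := 2) (bcx M) (bvec a b) x else 0) = (M : ℤ) := by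
      rw [Finset.sum_image fun i _ j _ h => fac_inj h]
      have : ∀ j : Fin M, (if col ∘ fac j = Fin.castSucc then
          sgn (n := 2) (bcx M) (bvec a b) (fac j) else 0) = 1 := by
        intro j
        rw [if_pos (by funext k; exact Fin.ext (fac_col h3 j k)), sgn_of_face (fac_face j),
          fac_dt, sign_pos (hpos j)]
        rfl
      simp [this]
    rw [← h1]
    symm
    refine Finset.sum_subset (Finset.subset_univ _) fun x _ hx => ?_
    by_contra hne
    apply hx
    split_ifs at hne with hcx
    · obtain ⟨-, hf⟩ := sgn_ne hne
      obtain ⟨j, rfl⟩ := fac_of h3 hf fun k => congrArg Fin.val (congrFun hcx k)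
      simp
    · exact absurd rfl hne

lemma good_all {k : ℕ} (hk : 1 ≤ k) {n : ℕ} (hn : 2 ≤ n) :
    Good (Fin (6 * k + n)) n (3 * k : ℤ) := by
  induction n, hn using Nat.le_induction with
  | base =>
    have h := good_base (M := 3 * k) (by omega) ⟨k, rfl⟩
    have e : Fintype.card (BV (3 * k)) = 6 * k + 2 := by simp; ring
    have := h.transport (Fintype.equivFinOfCardEq e)
    push_cast at this
    exact this
  | succ n hn ih =>
    have h := ih.step ⟨0, by omega⟩
    exact h.transport (Fintype.equivFinOfCardEq (by simp; ring))

end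

end Stmt8

/-- For every nonzero `d` there is a triangulated `n`-sphere with `6|d| + n` vertices
admitting a simplicial map of degree `3d` to `S^n_{n+2}`. -/
theorem stmt8 (d : ℤ) (hd : d ≠ 0) (n : ℕ) (hn : 2 ≤ n) :
    ∃ K : AbsCx (Fin (6 * d.natAbs + n)),
      K.vertexSet = Set.univ ∧ K.IsSphereTriangulation n ∧
      ∃ (oK : CoherentOrientation n K) (oL : CoherentOrientation n (stdSphere n))
        (f : Fin (6 * d.natAbs + n) → Fin (n + 2)),
        K.IsSimplicialMap (stdSphere n) f ∧ HasDegree oK oL f (3 * d) := by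
  have hk : 1 ≤ d.natAbs := by omega
  refine (Stmt8.good_all hk hn).final (3 * d) (by omega) (by omega)
end

section
/- For every nonzero integer d, there exists a triangulated n-sphere with 6|d| + n + 3 vertices admitting a simplicial map of degree 3d + sign(d) to S^n_{n+2}. -/
open Finset

open AbsCx

section Algebra

variable {V W U : Type*}

theorem algSum_comp [Fintype V] [Fintype W] {n : ℕ} (s : (Fin (n+1) → V) → ℤ)
    (f : V → W) (g : W → U) (y : Fin (n+1) → U) :
    algSum (algSum s f) g y = algSum s (g ∘ f) y := by
  classical
  unfold algSum
  have h1 : ∀ x : Fin (n+1) → W,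
      (if g ∘ x = y then ∑ z : Fin (n+1) → V, (if f ∘ z = x then s z else 0) else 0)
      = ∑ z : Fin (n+1) → V, if f ∘ z = x then (if g ∘ x = y then s z else 0) else 0 := by
    intro x
    split_ifs with h
    · rfl
    · simp
  rw [Finset.sum_congr rfl (fun x _ => h1 x), Finset.sum_comm]
  refine Finset.sum_congr rfl fun z _ => ?_
  rw [Finset.sum_ite_eq]
  simp [Function.comp_assoc]

theorem algSum_inj [Fintype V] {n : ℕ} (s : (Fin (n+1) → V) → ℤ)
    (f : V → W) (hf : Function.Injective f) (z : Fin (n+1) → V) :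
    algSum s f (f ∘ z) = s z := by
  classical
  unfold algSum
  rw [Finset.sum_eq_single z]
  · simp
  · intro b _ hb
    rw [if_neg]
    intro h
    exact hb (hf.comp_left h)
  · simp

theorem algSum_zero [Fintype V] {n : ℕ} (s : (Fin (n+1) → V) → ℤ)
    (f : V → W) (x : Fin (n+1) → W) (h : ∃ i, x i ∉ Set.range f) :
    algSum s f x = 0 := by
  classical
  unfold algSum
  apply Finset.sum_eq_zero
  intro z _
  rw [if_neg]
  rintro rfl
  obtain ⟨i, hi⟩ := h
  exact hi ⟨z i, rfl⟩

theorem algSum_perm [Fintype V] {n : ℕ} (s : (Fin (n+1) → V) → ℤ) (f : V → W)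
    (hs : ∀ (x : Fin (n+1) → V) (σ : Equiv.Perm (Fin (n+1))),
      s (x ∘ σ) = (Equiv.Perm.sign σ : ℤ) * s x)
    (x : Fin (n+1) → W) (σ : Equiv.Perm (Fin (n+1))) :
    algSum s f (x ∘ σ) = (Equiv.Perm.sign σ : ℤ) * algSum s f x := by
  classical
  unfold algSum
  rw [Finset.mul_sum]
  symm
  refine Fintype.sum_equiv (Equiv.arrowCongr σ.symm (Equiv.refl V)) _ _ ?_
  intro z
  have e : (Equiv.arrowCongr σ.symm (Equiv.refl V)) z = z ∘ σ := by
    ext; simp [Equiv.arrowCongr]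
  rw [e, hs]
  have : f ∘ z ∘ σ = x ∘ σ ↔ f ∘ z = x := by
    rw [← Function.comp_assoc]
    exact (σ.surjective.injective_comp_right).eq_iff
  simp only [this]
  split_ifs <;> simp

theorem algSum_sub [Fintype V] {n : ℕ} (s t : (Fin (n+1) → V) → ℤ) (c : ℤ)
    (f : V → W) (y : Fin (n+1) → W) :
    algSum (fun x => s x - c * t x) f y = algSum s f y - c * algSum t f y := by
  classical
  unfold algSum
  rw [Finset.mul_sum, ← Finset.sum_sub_distrib]
  refine Finset.sum_congr rfl fun z _ => ?_
  split_ifs <;> simp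

/-- matrix whose determinant orients the boundary of the simplex on `w` -/
def orMat [DecidableEq V] {n : ℕ} (w : Fin (n+2) → V) (x : Fin (n+1) → V) :
    Matrix (Fin (n+2)) (Fin (n+2)) ℤ :=
  Matrix.of fun k => (Fin.cons 1 (fun j => if w k = x j then 1 else 0) : Fin (n+2) → ℤ)

/-- orientation of the boundary of the simplex on `w` -/
def orW [DecidableEq V] {n : ℕ} (w : Fin (n+2) → V) (x : Fin (n+1) → V) : ℤ := (orMat w x).det

open scoped Classical in
theorem orW_eq [DecidableEq V] {n : ℕ} (w : Fin (n+2) → V) (x : Fin (n+1) → V) :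
    orW w x = ∑ σ : Equiv.Perm (Fin (n+2)),
      if w ∘ σ ∘ Fin.succ = x then (Equiv.Perm.sign σ : ℤ) else 0 := by
  unfold orW
  rw [Matrix.det_apply']
  refine Finset.sum_congr rfl fun σ _ => ?_
  rw [Fin.prod_univ_succ]
  have : ∏ i : Fin (n+1), orMat w x (σ i.succ) i.succ
      = if w ∘ σ ∘ Fin.succ = x then 1 else 0 := by
    simp only [orMat, Matrix.of_apply, Fin.cons_succ, Finset.prod_boole]
    congr 1
    simp [funext_iff]
  rw [this]
  simp [orMat]

theorem algSum_orW [DecidableEq V] [DecidableEq W] [Fintype V] {n : ℕ} (w : Fin (n+2) → V)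
    (f : V → W) (y : Fin (n+1) → W) : algSum (orW w) f y = orW (f ∘ w) y := by
  classical
  rw [orW_eq]
  unfold algSum
  simp only [orW_eq]
  have h1 : ∀ x : Fin (n+1) → V,
      (if f ∘ x = y then ∑ σ : Equiv.Perm (Fin (n+2)),
        (if w ∘ σ ∘ Fin.succ = x then (Equiv.Perm.sign σ : ℤ) else 0) else 0)
      = ∑ σ : Equiv.Perm (Fin (n+2)),
        if w ∘ σ ∘ Fin.succ = x then (if f ∘ x = y then (Equiv.Perm.sign σ : ℤ) else 0) else 0 := by
    intro x
    split_ifs with h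
    · rfl
    · simp
  rw [Finset.sum_congr rfl (fun x _ => h1 x), Finset.sum_comm]
  refine Finset.sum_congr rfl fun z _ => ?_
  rw [Finset.sum_ite_eq]
  simp [Function.comp_assoc]

theorem orW_perm [DecidableEq V] {n : ℕ} (w : Fin (n+2) → V) (x : Fin (n+1) → V)
    (σ : Equiv.Perm (Fin (n+1))) :
    orW w (x ∘ σ) = (Equiv.Perm.sign σ : ℤ) * orW w x := by
  have h : orMat w (x ∘ σ) = (orMat w x).submatrix id (Equiv.Perm.decomposeFin.symm (0, σ)) := by
    ext k j
    refine Fin.cases ?_ (fun j => ?_) j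
    · simp [orMat]
    · simp [orMat]
  unfold orW
  rw [h, Matrix.det_permute']
  simp

theorem orW_zero_inj [DecidableEq V] {n : ℕ} (w : Fin (n+2) → V) (x : Fin (n+1) → V)
    (h : ¬ Function.Injective x) : orW w x = 0 := by
  unfold Function.Injective at h
  push Not at h
  obtain ⟨i, j, hij, hne⟩ := h
  apply Matrix.det_zero_of_column_eq (i := i.succ) (j := j.succ)
  · simpa using hne
  · intro k
    simp [orMat, hij]

theorem orW_zero_range [DecidableEq V] {n : ℕ} (w : Fin (n+2) → V) (x : Fin (n+1) → V)
    (h : ∃ j, x j ∉ Set.range w) : orW w x = 0 := by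
  obtain ⟨j, hj⟩ := h
  apply Matrix.det_eq_zero_of_column_eq_zero j.succ
  intro k
  simp only [orMat, Matrix.of_apply, Fin.cons_succ]
  rw [if_neg]
  intro h
  exact hj ⟨k, h⟩

theorem orW_comp [DecidableEq V] {n : ℕ} (w : Fin (n+2) → V) (hw : Function.Injective w)
    (x : Fin (n+1) → Fin (n+2)) : orW w (w ∘ x) = orW id x := by
  unfold orW orMat
  simp [hw.eq_iff]

theorem exists_succAbove {n : ℕ} (x : Fin (n+1) → Fin (n+2)) (hx : Function.Injective x) :
    ∃ (p : Fin (n+2)) (σ : Equiv.Perm (Fin (n+1))), x = p.succAbove ∘ σ := by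
  have : ¬ Function.Surjective x := by
    intro hs
    have := Fintype.card_le_of_surjective x hs
    simp at this
  unfold Function.Surjective at this
  push Not at this
  obtain ⟨p, hp⟩ := this
  choose g hg using fun j => Fin.exists_succAbove_eq (hp j)
  have gi : Function.Injective g := by
    intro a b hab
    apply hx
    rw [← hg a, ← hg b, hab]
  refine ⟨p, Equiv.ofBijective g (Finite.injective_iff_bijective.mp gi), ?_⟩
  ext j
  simp [hg]

theorem orW_succAbove {n : ℕ} (p : Fin (n+2)) : orW id p.succAbove = (-1) ^ (p : ℕ) := by
  unfold orW
  rw [Matrix.det_succ_row _ p, Fin.sum_univ_succ]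
  have h0 : ∑ i : Fin (n+1), (-1) ^ ((p : ℕ) + (i.succ : ℕ)) *
      (orMat id p.succAbove) p i.succ *
      ((orMat id p.succAbove).submatrix p.succAbove i.succ.succAbove).det = 0 := by
    apply Finset.sum_eq_zero
    intro i _
    have : orMat id p.succAbove p i.succ = 0 := by
      simp [orMat]
    rw [this]; simp
  rw [h0]
  have h1 : (orMat id p.succAbove).submatrix p.succAbove (Fin.succAbove 0) = 1 := by
    ext a b
    simp [orMat, Matrix.one_apply]
  rw [h1]
  simp [orMat]

theorem orW_unit_id {n : ℕ} (x : Fin (n+1) → Fin (n+2)) (hx : Function.Injective x) :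
    orW id x = 1 ∨ orW id x = -1 := by
  obtain ⟨p, σ, rfl⟩ := exists_succAbove x hx
  rw [orW_perm, orW_succAbove]
  rcases Int.units_eq_one_or (Equiv.Perm.sign σ) with h | h <;>
  rcases neg_one_pow_eq_or ℤ (p : ℕ) with h' | h' <;> simp [h, h']

theorem orW_unit [DecidableEq V] {n : ℕ} (w : Fin (n+2) → V) (hw : Function.Injective w)
    (x : Fin (n+1) → V) (hx : Function.Injective x) (hr : ∀ j, x j ∈ Set.range w) :
    orW w x = 1 ∨ orW w x = -1 := by
  choose g hg using hr
  have : x = w ∘ g := by ext j; simp [hg]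
  subst this
  rw [orW_comp w hw]
  exact orW_unit_id g hx.of_comp

theorem orW_coh_id {n : ℕ} (x y : Fin (n+1) → Fin (n+2)) (hx : Function.Injective x)
    (hy : Function.Injective y) (i : Fin (n+1)) (hi : x i ≠ y i) (hij : ∀ j, j ≠ i → x j = y j) :
    orW id y = - orW id x := by
  have hinj : Function.Injective (Fin.cons (y i) x : Fin (n+2) → Fin (n+2)) := by
    rw [Fin.cons_injective_iff]
    refine ⟨?_, hx⟩
    rintro ⟨j, hj⟩
    by_cases h : j = i
    · subst h; exact hi hj
    · rw [hij j h] at hj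
      exact h (hy hj)
  have hbij := Finite.injective_iff_bijective.mp hinj
  have hy' : orMat id y = (orMat id x).updateCol i.succ (fun k => if k = y i then 1 else 0) := by
    ext k j
    refine Fin.cases ?_ (fun j => ?_) j
    · simp [orMat, Matrix.updateCol_apply, (Fin.succ_ne_zero i).symm]
    · by_cases h : j = i
      · subst h; simp [orMat]
      · simp [orMat, Matrix.updateCol_apply, h, hij j h]
  have hx' : orMat id x = (orMat id x).updateCol i.succ (fun k => if k = x i then 1 else 0) := by
    ext k j
    refine Fin.cases ?_ (fun j => ?_) j
    · simp [orMat, Matrix.updateCol_apply, (Fin.succ_ne_zero i).symm]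
    · by_cases h : j = i
      · subst h; simp [orMat]
      · simp [orMat, Matrix.updateCol_apply, h]
  suffices h : orW id y + orW id x = 0 by linarith
  unfold orW
  rw [hy']
  nth_rw 2 [hx']
  rw [← Matrix.det_updateCol_add]
  apply Matrix.exists_mulVec_eq_zero_iff.mp
  refine ⟨Fin.cons (-1) (fun _ => 1), ?_, ?_⟩
  · intro h
    have := congrFun h 0
    simp at this
  · ext k
    simp only [Matrix.mulVec, dotProduct]
    rw [Fin.sum_univ_succ]
    simp only [Fin.cons_zero, Fin.cons_succ]
    have h1 : ∀ j : Fin (n+1), ((orMat id x).updateCol i.succ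
        ((fun k => if k = y i then 1 else 0) + (fun k => if k = x i then 1 else 0))) k j.succ * 1
        = (if k = x j then 1 else 0) + (if j = i then (if k = y i then 1 else 0) else 0) := by
      intro j
      by_cases h : j = i
      · subst h; simp [add_comm]
      · simp [orMat, Matrix.updateCol_apply, h]
    rw [Finset.sum_congr rfl (fun j _ => h1 j), Finset.sum_add_distrib]
    have h2 : ∑ j : Fin (n+2), (if k = (Fin.cons (y i) x : Fin (n+2) → Fin (n+2)) j
        then (1:ℤ) else 0) = 1 := by
      obtain ⟨j0, hj0⟩ := hbij.2 k
      rw [Finset.sum_eq_single j0]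
      · simp [hj0]
      · intro b _ hb
        rw [if_neg]
        intro h
        exact hb (hinj (h.symm.trans hj0.symm))
      · simp
    rw [Fin.sum_univ_succ] at h2
    simp only [Fin.cons_zero, Fin.cons_succ] at h2
    have h3 : ((orMat id x).updateCol i.succ
        ((fun k => if k = y i then 1 else 0) + (fun k => if k = x i then 1 else 0))) k 0 = 1 := by
      simp [orMat, Matrix.updateCol_apply, (Fin.succ_ne_zero i).symm]
    rw [h3]
    simp only [Finset.sum_ite_eq', Finset.mem_univ, if_true, Pi.zero_apply]
    linarith

theorem orW_coh [DecidableEq V] {n : ℕ} (w : Fin (n+2) → V) (hw : Function.Injective w)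
    (x y : Fin (n+1) → V) (hx : Function.Injective x) (hy : Function.Injective y)
    (hrx : ∀ j, x j ∈ Set.range w) (hry : ∀ j, y j ∈ Set.range w)
    (i : Fin (n+1)) (hi : x i ≠ y i) (hij : ∀ j, j ≠ i → x j = y j) :
    orW w y = - orW w x := by
  choose g hg using hrx
  choose g' hg' using hry
  have e : x = w ∘ g := by ext j; simp [hg]
  have e' : y = w ∘ g' := by ext j; simp [hg']
  subst e e'
  rw [orW_comp w hw, orW_comp w hw]
  exact orW_coh_id g g' hx.of_comp hy.of_comp i (fun h => hi (by simp [h]))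
    (fun j hj => hw (hij j hj))

/-- sign of a self-map of `Fin m` (zero if not a permutation). -/
def dsgn {m : ℕ} (u : Fin m → Fin m) : ℤ :=
  (Matrix.of fun a b => if u a = b then (1:ℤ) else 0).det

theorem orW_dsgn {n : ℕ} (u : Fin (n+2) → Fin (n+2)) (y : Fin (n+1) → Fin (n+2)) :
    orW u y = dsgn u * orW id y := by
  unfold orW dsgn
  rw [← Matrix.det_mul]
  congr 1
  ext k j
  rw [Matrix.mul_apply]
  simp [orMat]

theorem dsgn_zero {m : ℕ} (u : Fin m → Fin m) (h : ¬ Function.Injective u) : dsgn u = 0 := by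
  unfold Function.Injective at h
  push Not at h
  obtain ⟨i, j, hij, hne⟩ := h
  apply Matrix.det_zero_of_row_eq hne
  ext k
  simp [hij]

theorem dsgn_unit {m : ℕ} (u : Fin m → Fin m) (h : Function.Injective u) :
    dsgn u = 1 ∨ dsgn u = -1 := by
  let e := Equiv.ofBijective u (Finite.injective_iff_bijective.mp h)
  have : dsgn u * (Matrix.of fun a b => if e.symm a = b then (1:ℤ) else 0).det = 1 := by
    unfold dsgn
    rw [← Matrix.det_mul]
    rw [show (Matrix.of fun a b => if u a = b then (1:ℤ) else 0) *
      (Matrix.of fun a b => if e.symm a = b then (1:ℤ) else 0) = 1 from ?_, Matrix.det_one]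
    ext a b
    rw [Matrix.mul_apply]
    have : ∀ c, e.symm (u c) = c := fun c => e.symm_apply_apply c
    simp only [Matrix.of_apply, Matrix.one_apply, ite_mul, one_mul, zero_mul,
      Finset.sum_ite_eq, Finset.mem_univ, if_true, this]
  exact Int.isUnit_iff.mp (IsUnit.of_mul_eq_one _ this)

theorem dsgn_swap {m : ℕ} (u : Fin m → Fin m) (i j : Fin m) (h : i ≠ j) :
    dsgn (u ∘ Equiv.swap i j) = - dsgn u := by
  have := Matrix.det_permute (Equiv.swap i j) (Matrix.of fun a b => if u a = b then (1:ℤ) else 0)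
  rw [Equiv.Perm.sign_swap h] at this
  unfold dsgn
  rw [show (Matrix.of fun a b => if (u ∘ Equiv.swap i j) a = b then (1:ℤ) else 0) =
    (Matrix.of fun a b => if u a = b then (1:ℤ) else 0).submatrix (Equiv.swap i j) id from ?_, this]
  · simp
  · ext a b; simp

end Algebra
section Topology

theorem mem_realization {V : Type*} [Fintype V] (K : AbsCx V) (g : V → ℝ) :
    g ∈ K.realization ↔ (∀ v, 0 ≤ g v) ∧ ∑ v, g v = 1 ∧
      (Finset.univ.filter (fun v => g v ≠ 0)) ∈ K.faces := by
  classical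
  constructor
  · rintro ⟨h0, s, hs, hz, h1⟩
    have hsum : ∑ v, g v = 1 := by
      rw [← h1]
      symm
      apply Finset.sum_subset (Finset.subset_univ s)
      intro v _ hv
      exact hz v hv
    refine ⟨h0, hsum, K.down_closed hs ?_ ?_⟩
    · intro v hv
      by_contra h
      simp [hz v h] at hv
    · by_contra h
      rw [Finset.not_nonempty_iff_eq_empty, Finset.filter_eq_empty_iff] at h
      have : ∑ v, g v = 0 := Finset.sum_eq_zero fun v _ => by simpa using h (Finset.mem_univ v)
      linarith
  · rintro ⟨h0, h1, hs⟩
    refine ⟨h0, _, hs, ?_, ?_⟩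
    · intro v hv
      simpa using hv
    · rw [Finset.sum_filter_ne_zero]
      exact h1

theorem mem_std {n : ℕ} (g : Fin (n+2) → ℝ) :
    g ∈ (stdSphere n).realization ↔ (∀ v, 0 ≤ g v) ∧ ∑ v, g v = 1 ∧ ∃ v, g v = 0 := by
  rw [mem_realization]
  refine and_congr_right fun h0 => and_congr_right fun h1 => ?_
  constructor
  · rintro ⟨_, h⟩
    by_contra hc
    push Not at hc
    exact h (by simpa [Finset.filter_eq_self] using hc)
  · rintro ⟨v, hv⟩
    constructor
    · by_contra h
      rw [Finset.not_nonempty_iff_eq_empty, Finset.filter_eq_empty_iff] at h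
      have : ∑ v, g v = 0 := Finset.sum_eq_zero fun v _ => by simpa using h (Finset.mem_univ v)
      linarith
    · intro h
      have := Finset.mem_univ v
      rw [← h] at this
      simp [hv] at this

/-- minimum -/
noncomputable def mn {m : ℕ} (x : Fin (m+1) → ℝ) : ℝ :=
  (Finset.univ : Finset (Fin (m+1))).inf' Finset.univ_nonempty x

theorem mn_le {m : ℕ} (x : Fin (m+1) → ℝ) (i) : mn x ≤ x i := Finset.inf'_le _ (Finset.mem_univ i)

theorem mn_ex {m : ℕ} (x : Fin (m+1) → ℝ) : ∃ i, mn x = x i := by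
  obtain ⟨i, _, h⟩ := Finset.exists_mem_eq_inf' (Finset.univ_nonempty) x
  exact ⟨i, h⟩

theorem mn_unique {m : ℕ} (x : Fin (m+1) → ℝ) (i) (h : ∀ j, x i ≤ x j) : mn x = x i := by
  obtain ⟨j, hj⟩ := mn_ex x
  exact le_antisymm (mn_le x i) (hj ▸ h j)

theorem continuous_mn {m : ℕ} : Continuous (mn : (Fin (m+1) → ℝ) → ℝ) := by
  unfold mn
  exact Continuous.finset_inf'_apply _ (fun i _ => continuous_apply i)

theorem std_sphere (n : ℕ) : (stdSphere n).IsSphereTriangulation n := by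
  -- extension
  let ex : EuclideanSpace ℝ (Fin (n+1)) → (Fin (n+2) → ℝ) := fun x => Fin.snoc (α := fun _ => ℝ) (fun i => x i) 0
  have exc : Continuous ex := by
    refine continuous_pi fun i => ?_
    refine Fin.lastCases ?_ (fun i => ?_) i
    · simp only [ex, Fin.snoc_last]; exact continuous_const
    · simp only [ex, Fin.snoc_castSucc]; fun_prop
  let Y : EuclideanSpace ℝ (Fin (n+1)) → (Fin (n+2) → ℝ) := fun x i => ex x i - mn (ex x)
  have Yc : Continuous Y := by
    refine continuous_pi fun i => ?_
    exact ((continuous_apply i).comp exc).sub (continuous_mn.comp exc)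
  have Y0 : ∀ x i, 0 ≤ Y x i := fun x i => sub_nonneg.mpr (mn_le _ i)
  have Yex : ∀ x, ∃ i, Y x i = 0 := fun x => by
    obtain ⟨i, hi⟩ := mn_ex (ex x)
    exact ⟨i, by simp [Y, hi]⟩
  have Ypos : ∀ x : EuclideanSpace ℝ (Fin (n+1)), x ≠ 0 → 0 < ∑ i, Y x i := by
    intro x hx
    refine lt_of_le_of_ne (Finset.sum_nonneg fun i _ => Y0 x i) ?_
    intro h
    apply hx
    have h2 := (Finset.sum_eq_zero_iff_of_nonneg (fun i _ => Y0 x i)).mp h.symm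
    have hl : Y x (Fin.last _) = 0 := h2 _ (Finset.mem_univ _)
    ext i
    have hi : Y x i.castSucc = 0 := h2 _ (Finset.mem_univ _)
    simp only [Y, ex, Fin.snoc_last, Fin.snoc_castSucc] at hl hi
    simp only [PiLp.zero_apply]
    linarith
  let R : (Fin (n+2) → ℝ) → EuclideanSpace ℝ (Fin (n+1)) := fun g => WithLp.toLp 2 (fun i => g i.castSucc - g (Fin.last _))
  have Rc : Continuous R := by fun_prop
  have Rne : ∀ g ∈ (stdSphere n).realization, R g ≠ 0 := by
    intro g hg h
    rw [mem_std] at hg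
    obtain ⟨h0, h1, v, hv⟩ := hg
    have hh : ∀ i, g i = g (Fin.last _) := by
      intro i
      refine Fin.lastCases rfl (fun i => ?_) i
      have := congrFun (congrArg WithLp.ofLp h) i
      simp [R] at this
      linarith
    have : ∀ i, g i = 0 := fun i => by rw [hh i, ← hh v, hv]
    simp [this] at h1
  have sne : ∀ x : Metric.sphere (0 : EuclideanSpace ℝ (Fin (n+1))) 1, (x : EuclideanSpace ℝ (Fin (n+1))) ≠ 0 := fun x h => by
    have := x.2
    rw [h] at this
    simp at this
  refine ⟨Homeomorph.symm
    { toFun := fun x => ⟨fun i => Y x i / ∑ j, Y x j, ?_⟩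
      invFun := fun g => ⟨‖R g‖⁻¹ • R g, ?_⟩
      left_inv := ?_
      right_inv := ?_
      continuous_toFun := ?_
      continuous_invFun := ?_ }⟩
  · have hp := Ypos x (sne x)
    rw [mem_std]
    refine ⟨fun v => div_nonneg (Y0 _ _) hp.le, ?_, ?_⟩
    · rw [← Finset.sum_div, div_self hp.ne']
    · obtain ⟨i, hi⟩ := Yex x
      exact ⟨i, by simp [hi]⟩
  · have := Rne g g.2
    rw [mem_sphere_zero_iff_norm, norm_smul, norm_inv, norm_norm]
    exact inv_mul_cancel₀ (norm_ne_zero_iff.mpr this)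
  · intro x
    ext1
    have hp := Ypos x (sne x)
    have hR : R (fun i => Y x i / ∑ j, Y x j) = (∑ j, Y x j)⁻¹ • (x : EuclideanSpace ℝ (Fin (n+1))) := by
      ext i
      simp only [R, Y, ex, Fin.snoc_last, Fin.snoc_castSucc, PiLp.smul_apply, smul_eq_mul]
      ring
    simp only [hR]
    have hx : ‖(x : EuclideanSpace ℝ (Fin (n+1)))‖ = 1 := by simpa using x.2
    rw [norm_smul, hx, mul_one, norm_inv, Real.norm_of_nonneg hp.le, inv_inv, smul_smul,
      mul_inv_cancel₀ hp.ne', one_smul]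
  · intro g
    ext1
    have hne := Rne g g.2
    have hg := g.2
    rw [mem_std] at hg
    obtain ⟨h0, h1, v, hv⟩ := hg
    set c := ‖R g‖⁻¹ with hc
    have hcpos : 0 < c := inv_pos.mpr (norm_pos_iff.mpr hne)
    have hex : ∀ i, ex (c • R g) i = c * (g.1 i - g.1 (Fin.last _)) := by
      intro i
      refine Fin.lastCases ?_ (fun i => ?_) i
      · simp [ex]
      · simp [ex, R]
    have hmn : mn (ex (c • R g)) = c * (0 - g.1 (Fin.last _)) := by
      rw [mn_unique _ v]
      · rw [hex, hv]
      · intro j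
        rw [hex, hex, hv]
        have := h0 j
        gcongr
    have hY : ∀ i, Y (c • R g) i = c * g.1 i := by
      intro i
      simp only [Y]
      rw [hmn, hex]
      ring
    ext i
    change Y (c • R g) i / ∑ j, Y (c • R g) j = _
    simp only [hY]
    rw [← Finset.mul_sum, h1, mul_one]
    field_simp
  · refine Continuous.subtype_mk (continuous_pi fun i => ?_) _
    refine Continuous.div ?_ ?_ ?_
    · exact ((continuous_apply i).comp Yc).comp continuous_subtype_val
    · exact (continuous_finsetSum _ fun j _ => (continuous_apply j).comp Yc).comp
        continuous_subtype_val
    · intro x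
      exact (Ypos x (sne x)).ne'
  · refine Continuous.subtype_mk ?_ _
    refine Continuous.smul (f := fun g : (stdSphere n).realization => ‖R g‖⁻¹)
      (Continuous.inv₀ (f := fun g : (stdSphere n).realization => ‖R g‖) ?_ ?_) ?_
    · exact (Rc.comp continuous_subtype_val).norm
    · intro g
      exact norm_ne_zero_iff.mpr (Rne g g.2)
    · exact Rc.comp continuous_subtype_val

end Topology
section Stack

/-- the old vertices of a set of vertices -/
def pre {N : ℕ} (s : Finset (Fin (N+1))) : Finset (Fin N) :=
  Finset.univ.filter fun v => v.castSucc ∈ s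

theorem mem_pre {N : ℕ} (s : Finset (Fin (N+1))) (v : Fin N) : v ∈ pre s ↔ v.castSucc ∈ s := by
  simp [pre]

theorem pre_mono {N : ℕ} {s t : Finset (Fin (N+1))} (h : s ⊆ t) : pre s ⊆ pre t := by
  intro v hv
  rw [mem_pre] at *
  exact h hv

theorem card_pre {N : ℕ} (s : Finset (Fin (N+1))) :
    s.card = (pre s).card + if Fin.last N ∈ s then 1 else 0 := by
  have h : s = (pre s).map Fin.castSuccEmb ∪ (if Fin.last N ∈ s then {Fin.last N} else ∅) := by
    ext v
    refine Fin.lastCases ?_ (fun v => ?_) v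
    · by_cases h : Fin.last N ∈ s <;> simp [h]
    · by_cases h : Fin.last N ∈ s <;> simp [h, mem_pre]
  conv_lhs => rw [h]
  rw [Finset.card_union_of_disjoint]
  · rw [Finset.card_map]
    split_ifs <;> simp
  · rw [Finset.disjoint_left]
    intro v hv
    simp only [Finset.mem_map] at hv
    obtain ⟨a, _, rfl⟩ := hv
    split_ifs <;> simp

/-- stacking a new vertex on the facet `F`. -/
def stackCx {N : ℕ} (K : AbsCx (Fin N)) (F : Finset (Fin N))
    (hmax : ∀ s ∈ K.faces, F ⊆ s → s = F) (hF : F ∈ K.faces) : AbsCx (Fin (N+1)) where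
  faces := {s | s.Nonempty ∧ (Fin.last N ∈ s → pre s ⊂ F) ∧
    (Fin.last N ∉ s → pre s ∈ K.faces ∧ pre s ≠ F)}
  nonempty_of_mem := fun s h => h.1
  down_closed := by
    rintro s t ⟨_, h1, h2⟩ hts ht
    refine ⟨ht, fun h => ?_, fun h => ?_⟩
    · exact lt_of_le_of_lt (pre_mono hts) (h1 (hts h))
    · have hne : (pre t).Nonempty := by
        obtain ⟨v, hv⟩ := ht
        revert hv
        refine Fin.lastCases (fun hv => absurd hv h) (fun v hv => ?_) v
        exact ⟨v, (mem_pre _ _).mpr hv⟩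
      by_cases hl : Fin.last N ∈ s
      · have := lt_of_le_of_lt (pre_mono hts) (h1 hl)
        exact ⟨K.down_closed hF this.le hne, this.ne⟩
      · obtain ⟨h3, h4⟩ := h2 hl
        refine ⟨K.down_closed h3 (pre_mono hts) hne, ?_⟩
        intro h5
        exact h4 (hmax _ h3 (h5 ▸ pre_mono hts))

variable {N : ℕ} (K : AbsCx (Fin N)) (F : Finset (Fin N))
    (hmax : ∀ s ∈ K.faces, F ⊆ s → s = F) (hF : F ∈ K.faces)

/-- minimum over F -/
noncomputable def mnF (hne : F.Nonempty) (h : Fin N → ℝ) : ℝ := F.inf' hne h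

theorem continuous_mnF (hne : F.Nonempty) : Continuous (mnF F hne) := by
  unfold mnF
  exact Continuous.finset_inf'_apply _ (fun i _ => continuous_apply i)

theorem stack_vertex (h2 : 2 ≤ F.card) (hK : K.vertexSet = Set.univ) :
    (stackCx K F hmax hF).vertexSet = Set.univ := by
  rw [Set.eq_univ_iff_forall]
  intro v
  refine ⟨by simp, ?_, ?_⟩
  · intro h
    have : v = Fin.last N := (Finset.mem_singleton.mp h).symm
    subst this
    have : pre {Fin.last N} = ∅ := by
      ext v; simp [mem_pre]
    rw [this]
    exact Finset.empty_ssubset.mpr (K.nonempty_of_mem hF)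
  · refine Fin.lastCases ?_ (fun v => ?_) v
    · simp
    · intro _
      have : pre {v.castSucc} = {v} := by
        ext v; simp [mem_pre]
      rw [this]
      refine ⟨?_, ?_⟩
      · have : v ∈ K.vertexSet := by rw [hK]; trivial
        exact this
      · rintro rfl
        simp at h2

theorem stack_card {n : ℕ} (hc : F.card = n + 1) (hK : ∀ s ∈ K.faces, s.card ≤ n + 1) :
    ∀ s ∈ (stackCx K F hmax hF).faces, s.card ≤ n + 1 := by
  rintro s ⟨_, h1, h2⟩
  rw [card_pre]
  split_ifs with h
  · have := Finset.card_lt_card (h1 h)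
    omega
  · exact hK _ (h2 h).1

theorem stack_homeo (n : ℕ) (hc : F.card = n + 1) :
    Nonempty ((stackCx K F hmax hF).realization ≃ₜ K.realization) := by
  have hne := K.nonempty_of_mem hF
  have hn0 : (0:ℝ) < n + 1 := by positivity
  have hsumF : ∀ c : ℝ, ∑ v, (if v ∈ F then c else 0) = (n + 1) * c := by
    intro c
    rw [← Finset.sum_filter]
    simp [hc]
  have key : ∀ g : Fin (N+1) → ℝ, pre (Finset.univ.filter fun v => g v ≠ 0) =
      Finset.univ.filter fun v : Fin N => g v.castSucc ≠ 0 := by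
    intro g
    ext v
    simp [mem_pre]
  have hzero : ∀ g ∈ (stackCx K F hmax hF).realization, ∃ v ∈ F, g v.castSucc = 0 := by
    intro g hg
    rw [mem_realization] at hg
    obtain ⟨h0, h1, _, h2, h3⟩ := hg
    rw [key] at h2 h3
    by_contra hcon
    push Not at hcon
    have hsub : F ⊆ Finset.univ.filter fun v : Fin N => g v.castSucc ≠ 0 := by
      intro v hv
      simp [hcon v hv]
    by_cases hl : g (Fin.last N) = 0
    · obtain ⟨h4, h5⟩ := h3 (by simp [hl])
      exact h5 (hmax _ h4 hsub)
    · exact (h2 (by simp [hl])).2 hsub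
  refine ⟨
    { toFun := fun g => ⟨fun v => g.1 v.castSucc + if v ∈ F then g.1 (Fin.last N) / (n+1) else 0, ?_⟩
      invFun := fun h => ⟨Fin.snoc (α := fun _ => ℝ)
        (fun v => h.1 v - if v ∈ F then mnF F hne h.1 else 0) ((n+1) * mnF F hne h.1), ?_⟩
      left_inv := ?_
      right_inv := ?_
      continuous_toFun := ?_
      continuous_invFun := ?_ }⟩
  · have hg := g.2
    rw [mem_realization] at hg ⊢
    obtain ⟨h0, h1, _, h2, h3⟩ := hg
    rw [key] at h2 h3
    have hpos : ∀ v, 0 ≤ (if v ∈ F then g.1 (Fin.last N) / (n+1) else 0) := by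
      intro v
      split_ifs
      · exact div_nonneg (h0 _) hn0.le
      · exact le_rfl
    refine ⟨fun v => add_nonneg (h0 _) (hpos v), ?_, ?_⟩
    · rw [Finset.sum_add_distrib, hsumF, mul_div_cancel₀ _ hn0.ne']
      rw [Fin.sum_univ_castSucc] at h1
      exact h1
    · by_cases hl : g.1 (Fin.last N) = 0
      · have := (h3 (by simp [hl])).1
        simpa [hl] using this
      · have hlp : 0 < g.1 (Fin.last N) / (n+1) := div_pos (lt_of_le_of_ne (h0 _) (Ne.symm hl)) hn0
        have hs := h2 (by simp [hl])
        convert hF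
        ext v
        simp only [Finset.mem_filter, Finset.mem_univ, true_and]
        by_cases hv : v ∈ F
        · simp only [hv, if_true, iff_true]
          exact (add_pos_of_nonneg_of_pos (h0 _) hlp).ne'
        · simp only [hv, if_false, add_zero, iff_false, not_not]
          by_contra hcon
          exact hv (hs.1 (by simp [hcon]))
  · have hh := h.2
    rw [mem_realization] at hh ⊢
    obtain ⟨h0, h1, h2⟩ := hh
    set m := mnF F hne h.1 with hm
    obtain ⟨v0, hv0, hmv⟩ := Finset.exists_mem_eq_inf' hne h.1
    replace hmv : m = h.1 v0 := hmv
    have hle : ∀ v ∈ F, m ≤ h.1 v := fun v hv => Finset.inf'_le _ hv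
    have hm0 : 0 ≤ m := hmv ▸ h0 v0
    have hnonneg : ∀ v, 0 ≤ h.1 v - if v ∈ F then m else 0 := by
      intro v
      split_ifs with hv
      · exact sub_nonneg.mpr (hle v hv)
      · simpa using h0 v
    have hsum : ∑ v, (Fin.snoc (α := fun _ => ℝ)
        (fun v => h.1 v - if v ∈ F then m else 0) ((n+1) * m) : Fin (N+1) → ℝ) v = 1 := by
      rw [Fin.sum_univ_castSucc]
      simp only [Fin.snoc_castSucc, Fin.snoc_last]
      rw [Finset.sum_sub_distrib, hsumF, h1]
      ring
    refine ⟨?_, hsum, ?_, ?_, ?_⟩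
    · intro v
      refine Fin.lastCases ?_ (fun v => ?_) v
      · simp only [Fin.snoc_last]; positivity
      · simp only [Fin.snoc_castSucc]; exact hnonneg v
    · by_contra hcon
      rw [Finset.not_nonempty_iff_eq_empty, Finset.filter_eq_empty_iff] at hcon
      rw [Finset.sum_eq_zero (fun v _ => by simpa using hcon (Finset.mem_univ v))] at hsum
      exact zero_ne_one hsum
    · intro hl
      rw [key]
      simp only [Fin.snoc_castSucc]
      simp only [Finset.mem_filter, Finset.mem_univ, true_and, Fin.snoc_last] at hl
      have hmpos : 0 < m := lt_of_le_of_ne hm0 (fun e => hl (by rw [← e]; simp))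
      have hsupp := hmax _ h2 (by
        intro v hv
        simp [(lt_of_lt_of_le hmpos (hle v hv)).ne'])
      rw [Finset.ssubset_iff_of_subset]
      · exact ⟨v0, hv0, by simp [hv0, hmv]⟩
      · intro v hv
        by_contra hvF
        simp only [Finset.mem_filter, Finset.mem_univ, true_and, hvF, if_false, sub_zero] at hv
        apply hvF
        rw [← hsupp]
        simp [hv]
    · intro hl
      rw [key]
      simp only [Fin.snoc_castSucc]
      simp only [Finset.mem_filter, Finset.mem_univ, true_and, Fin.snoc_last, not_not] at hl
      have hmz : m = 0 := by
        rcases mul_eq_zero.mp hl with h | h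
        · exact absurd h hn0.ne'
        · exact h
      simp only [hmz, ite_self, sub_zero]
      refine ⟨h2, ?_⟩
      intro e
      rw [← e] at hv0
      simp [← hmv, hmz] at hv0
  · intro g
    obtain ⟨v0, hv0, hz⟩ := hzero g.1 g.2
    have hg := g.2
    rw [mem_realization] at hg
    have hmn : mnF F hne (fun v => g.1 v.castSucc + if v ∈ F then g.1 (Fin.last N) / (n+1) else 0)
        = g.1 (Fin.last N) / (n+1) := by
      apply le_antisymm
      · have := Finset.inf'_le
          (fun v => g.1 v.castSucc + if v ∈ F then g.1 (Fin.last N) / (n+1) else 0) hv0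
        simp only [hz, hv0, if_true, zero_add] at this
        exact this
      · apply Finset.le_inf'
        intro v hv
        simp only [hv, if_true]
        linarith [hg.1 v.castSucc]
    ext v
    simp only [hmn]
    refine Fin.lastCases ?_ (fun v => ?_) v
    · simp only [Fin.snoc_last]
      field_simp
    · simp only [Fin.snoc_castSucc]
      ring
  · intro h
    ext v
    simp only [Fin.snoc_last, Fin.snoc_castSucc]
    split_ifs
    · field_simp
      ring
    · ring
  · refine Continuous.subtype_mk (continuous_pi fun v => ?_) _
    have h1 : ∀ u, Continuous fun g : (stackCx K F hmax hF).realization => g.1 u :=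
      fun u => (continuous_apply u).comp continuous_subtype_val
    split_ifs
    · exact (h1 _).add ((h1 _).div_const _)
    · exact (h1 _).add continuous_const
  · have hcm : Continuous fun h : K.realization => mnF F hne h.1 :=
      (continuous_mnF F hne).comp continuous_subtype_val
    refine Continuous.subtype_mk (continuous_pi fun v => ?_) _
    refine Fin.lastCases ?_ (fun v => ?_) v
    · simp only [Fin.snoc_last]
      fun_prop
    · simp only [Fin.snoc_castSucc]
      have h1 : ∀ u, Continuous fun g : K.realization => g.1 u :=
        fun u => (continuous_apply u).comp continuous_subtype_val
      split_ifs
      · exact (h1 _).sub hcm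
      · exact (h1 _).sub continuous_const

end Stack
section StackOr

variable {n N : ℕ} (K : AbsCx (Fin N)) (o : CoherentOrientation n K)
  (z0 : Fin (n+1) → Fin N) (hz0 : Function.Injective z0)
  (hF : Finset.image z0 Finset.univ ∈ K.faces) (hK : ∀ s ∈ K.faces, s.card ≤ n + 1)

/-- vertices of the cone -/
def coneW (z0 : Fin (n+1) → Fin N) : Fin (n+2) → Fin (N+1) :=
  Fin.cons (Fin.last N) (Fin.castSucc ∘ z0)

theorem coneW_inj (hz0 : Function.Injective z0) : Function.Injective (coneW z0) := by
  unfold coneW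
  rw [Fin.cons_injective_iff]
  refine ⟨?_, (Fin.castSucc_injective N).comp hz0⟩
  rintro ⟨i, hi⟩
  exact (Fin.castSucc_lt_last (z0 i)).ne hi

theorem mem_coneW_last : Fin.last N ∈ Set.range (coneW z0) := ⟨0, rfl⟩

theorem mem_coneW_cast (v : Fin N) :
    v.castSucc ∈ Set.range (coneW z0) ↔ v ∈ Finset.image z0 Finset.univ := by
  constructor
  · rintro ⟨i, hi⟩
    revert hi
    refine Fin.cases (fun hi => ?_) (fun i hi => ?_) i
    · exact absurd hi.symm (Fin.castSucc_lt_last v).ne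
    · simp only [coneW, Fin.cons_succ, Function.comp] at hi
      rw [← Fin.castSucc_injective N hi]
      simp
  · intro h
    simp only [Finset.mem_image, Finset.mem_univ, true_and] at h
    obtain ⟨i, rfl⟩ := h
    exact ⟨i.succ, rfl⟩

theorem card_img {V : Type*} [DecidableEq V] (z : Fin (n+1) → V) (hz : Function.Injective z) :
    (Finset.image z Finset.univ).card = n + 1 := by
  rw [Finset.card_image_of_injective _ hz]; simp

theorem img_max (hz0 : Function.Injective z0) (hK : ∀ s ∈ K.faces, s.card ≤ n + 1) :
    ∀ s ∈ K.faces, Finset.image z0 Finset.univ ⊆ s → s = Finset.image z0 Finset.univ := by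
  intro s hs h
  exact (Finset.eq_of_subset_of_card_le h (by rw [card_img z0 hz0]; exact hK s hs)).symm

/-- stacked sign -/
noncomputable def stackSign (s : (Fin (n+1) → Fin N) → ℤ) (z0 : Fin (n+1) → Fin N)
    (x : Fin (n+1) → Fin (N+1)) : ℤ :=
  algSum s Fin.castSucc x - s z0 * orW (coneW z0) x

theorem orW_cone_base (hz0 : Function.Injective z0) :
    orW (coneW z0) (Fin.castSucc ∘ z0) = 1 := by
  have : (Fin.castSucc ∘ z0) = coneW z0 ∘ (Fin.succAbove 0) := by
    ext j; simp [coneW]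
  rw [this, orW_comp _ (coneW_inj z0 hz0), orW_succAbove]
  simp

theorem stackSign_a (hz0 : Function.Injective z0) (z : Fin (n+1) → Fin N) (hz : Function.Injective z)
    (h : Finset.image z Finset.univ = Finset.image z0 Finset.univ) :
    stackSign o.sign z0 (Fin.castSucc ∘ z) = 0 := by
  have h1 : ∀ j, ∃ i, z0 i = z j := by
    intro j
    have : z j ∈ Finset.image z0 Finset.univ := by rw [← h]; simp
    simpa using this
  choose g hg using h1
  have gi : Function.Injective g := by
    intro a b hab
    apply hz
    rw [← hg a, ← hg b, hab]
  obtain ⟨σ, hσ⟩ : ∃ σ : Equiv.Perm (Fin (n+1)), z = z0 ∘ σ :=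
    ⟨Equiv.ofBijective g (Finite.injective_iff_bijective.mp gi), by ext j; simp [hg]⟩
  subst hσ
  unfold stackSign
  rw [algSum_inj _ _ (Fin.castSucc_injective N), o.sign_perm, ← Function.comp_assoc, orW_perm,
    orW_cone_base z0 hz0]
  ring

theorem stackSign_b (hz0 : Function.Injective z0) (z : Fin (n+1) → Fin N) (hz : Function.Injective z)
    (h : Finset.image z Finset.univ ≠ Finset.image z0 Finset.univ) :
    stackSign o.sign z0 (Fin.castSucc ∘ z) = o.sign z := by
  unfold stackSign
  rw [algSum_inj _ _ (Fin.castSucc_injective N), orW_zero_range]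
  · ring
  · by_contra hc
    push Not at hc
    apply h
    apply Finset.eq_of_subset_of_card_le
    · intro v hv
      simp only [Finset.mem_image, Finset.mem_univ, true_and] at hv
      obtain ⟨j, rfl⟩ := hv
      exact (mem_coneW_cast z0 _).mp (hc j)
    · rw [card_img z hz, card_img z0 hz0]

theorem stackSign_c (x : Fin (n+1) → Fin (N+1)) (h : ∃ j, x j = Fin.last N) :
    stackSign o.sign z0 x = - o.sign z0 * orW (coneW z0) x := by
  unfold stackSign
  rw [algSum_zero]
  · ring
  · obtain ⟨j, hj⟩ := h
    refine ⟨j, ?_⟩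
    rintro ⟨v, hv⟩
    rw [hj] at hv
    exact (Fin.castSucc_lt_last v).ne hv

theorem exists_cast (x : Fin (n+1) → Fin (N+1)) (h : ¬ ∃ j, x j = Fin.last N) :
    ∃ z : Fin (n+1) → Fin N, x = Fin.castSucc ∘ z := by
  push Not at h
  choose g hg using fun j => Fin.exists_castSucc_eq.mpr (h j)
  exact ⟨g, by ext j; simp [hg]⟩

theorem pre_img_cast (z : Fin (n+1) → Fin N) :
    pre (Finset.image (Fin.castSucc ∘ z) Finset.univ) = Finset.image z Finset.univ := by
  ext v; simp [mem_pre]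

theorem mem_stack_cast (z : Fin (n+1) → Fin N) :
    Finset.image (Fin.castSucc ∘ z) Finset.univ ∈
      (stackCx K _ (img_max K z0 hz0 hK) hF).faces ↔
    Finset.image z Finset.univ ∈ K.faces ∧
      Finset.image z Finset.univ ≠ Finset.image z0 Finset.univ := by
  have hl : Fin.last N ∉ Finset.image (Fin.castSucc ∘ z) Finset.univ := by
    simp [(Fin.castSucc_lt_last _).ne]
  constructor
  · rintro ⟨_, _, h⟩
    have := h hl
    rwa [pre_img_cast] at this
  · intro h
    refine ⟨by simp, fun h => absurd h hl, fun _ => ?_⟩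
    rwa [pre_img_cast]

theorem mem_stack_last (x : Fin (n+1) → Fin (N+1)) (hx : Function.Injective x)
    (h : ∃ j, x j = Fin.last N) :
    Finset.image x Finset.univ ∈ (stackCx K _ (img_max K z0 hz0 hK) hF).faces ↔
      ∀ j, x j ∈ Set.range (coneW z0) := by
  have hl : Fin.last N ∈ Finset.image x Finset.univ := by simpa using h
  constructor
  · rintro ⟨_, h1, _⟩ j
    have h2 := (h1 hl).1
    rcases Fin.eq_castSucc_or_eq_last (x j) with ⟨v, hv⟩ | hv
    · rw [hv, mem_coneW_cast]
      apply h2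
      rw [mem_pre, ← hv]
      simp
    · rw [hv]; exact mem_coneW_last z0
  · intro hr
    refine ⟨by simp, fun _ => ?_, fun h => absurd hl h⟩
    rw [Finset.ssubset_iff_subset_ne]
    constructor
    · intro v hv
      rw [mem_pre] at hv
      simp only [Finset.mem_image, Finset.mem_univ, true_and] at hv
      obtain ⟨j, hj⟩ := hv
      rw [← mem_coneW_cast, ← hj]
      exact hr j
    · intro he
      have h1 := card_pre (Finset.image x Finset.univ)
      rw [if_pos hl, he, card_img x hx, card_img z0 hz0] at h1
      omega

theorem mixed_coh (hz0 : Function.Injective z0)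
    (hF : Finset.image z0 Finset.univ ∈ K.faces) (x : Fin (n+1) → Fin (N+1)) (z : Fin (n+1) → Fin N)
    (hx : Function.Injective x) (hz : Function.Injective z)
    (hj : ∃ j, x j = Fin.last N) (hr : ∀ j, x j ∈ Set.range (coneW z0))
    (hzK : Finset.image z Finset.univ ∈ K.faces)
    (hzF : Finset.image z Finset.univ ≠ Finset.image z0 Finset.univ)
    (i : Fin (n+1)) (hij : ∀ j, j ≠ i → x j = (z j).castSucc) :
    stackSign o.sign z0 (Fin.castSucc ∘ z) = - stackSign o.sign z0 x := by
  obtain ⟨j, hj⟩ := hj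
  have : j = i := by
    by_contra hne
    rw [hij j hne] at hj
    exact (Fin.castSucc_lt_last _).ne hj
  subst this
  obtain ⟨a, haF, ha⟩ : ∃ a ∈ Finset.image z0 Finset.univ, a ∉ (Finset.univ.erase j).image z := by
    apply Finset.exists_mem_notMem_of_card_lt_card
    rw [card_img z0 hz0, Finset.card_image_of_injective _ hz]
    simp
  have ha' : ∀ k, k ≠ j → z k ≠ a := by
    intro k hk h
    exact ha (Finset.mem_image.mpr ⟨k, by simp [hk], h⟩)
  let z1 := Function.update z j a
  have z1j : z1 j = a := by simp [z1]
  have z1k : ∀ k, k ≠ j → z1 k = z k := fun k hk => by simp [z1, hk]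
  have hz1 : Function.Injective z1 := by
    intro p q hpq
    by_cases hp : p = j
    · by_cases hq : q = j
      · rw [hp, hq]
      · rw [hp, z1j, z1k q hq] at hpq
        exact absurd hpq.symm (ha' q hq)
    · by_cases hq : q = j
      · rw [hq, z1j, z1k p hp] at hpq
        exact absurd hpq (ha' p hp)
      · rw [z1k p hp, z1k q hq] at hpq
        exact hz hpq
  have hz1F' : ∀ k, z1 k ∈ Finset.image z0 Finset.univ := by
    intro k
    by_cases hk : k = j
    · rw [hk, z1j]; exact haF
    · rw [z1k k hk, ← mem_coneW_cast, ← hij k hk]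
      exact hr k
  have hz1F : Finset.image z1 Finset.univ = Finset.image z0 Finset.univ := by
    apply Finset.eq_of_subset_of_card_le
    · intro v hv
      simp only [Finset.mem_image, Finset.mem_univ, true_and] at hv
      obtain ⟨k, rfl⟩ := hv
      exact hz1F' k
    · rw [card_img z1 hz1, card_img z0 hz0]
  have hne : z1 j ≠ z j := by
    intro h
    apply hzF
    rw [← hz1F]
    congr 1
    ext k
    by_cases hk : k = j
    · rw [hk, h]
    · rw [z1k k hk]
  have e1 := stackSign_a K o z0 hz0 z1 hz1 hz1F
  unfold stackSign at e1
  rw [algSum_inj _ _ (Fin.castSucc_injective N)] at e1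
  have s1 : o.sign z1 ≠ 0 := by
    rcases o.sign_unit z1 hz1 (hz1F ▸ hF) with h | h <;> rw [h] <;> simp
  have s2 : o.sign z ≠ 0 := by
    rcases o.sign_unit z hz hzK with h | h <;> rw [h] <;> simp
  have e2 := o.coherent z1 z ⟨j, hne, z1k⟩ s1 s2
  have e3 := orW_coh (coneW z0) (coneW_inj z0 hz0) x (Fin.castSucc ∘ z1) hx
    ((Fin.castSucc_injective N).comp hz1) hr
    (fun k => (mem_coneW_cast z0 _).mpr (hz1F' k)) j
    (by rw [hj]; exact (Fin.castSucc_lt_last _).ne')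
    (fun k hk => by rw [hij k hk]; simp [z1k k hk])
  rw [stackSign_b K o z0 hz0 z hz hzF, stackSign_c K o z0 x ⟨j, hj⟩, e2]
  rw [e3] at e1
  linarith

theorem stack_zero : ∀ x : Fin (n+1) → Fin (N+1),
    ¬ Function.Injective x ∨ Finset.image x Finset.univ ∉
      (stackCx K _ (img_max K z0 hz0 hK) hF).faces → stackSign o.sign z0 x = 0 := by
  intro x h
  by_cases hx : Function.Injective x
  · replace h := h.resolve_left (not_not.mpr hx)
    by_cases hj : ∃ j, x j = Fin.last N
    · rw [mem_stack_last K z0 hz0 hF hK x hx hj] at h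
      push Not at h
      rw [stackSign_c K o z0 x hj, orW_zero_range _ _ h, mul_zero]
    · obtain ⟨z, rfl⟩ := exists_cast x hj
      rw [mem_stack_cast K z0 hz0 hF hK] at h
      have hz := hx.of_comp
      by_cases he : Finset.image z Finset.univ = Finset.image z0 Finset.univ
      · exact stackSign_a K o z0 hz0 z hz he
      · rw [stackSign_b K o z0 hz0 z hz he]
        exact o.sign_zero z (Or.inr fun h' => h ⟨h', he⟩)
  · unfold stackSign
    rw [orW_zero_inj _ _ hx, mul_zero, sub_zero]
    by_cases hj : ∃ j, x j = Fin.last N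
    · apply algSum_zero
      obtain ⟨j, hj⟩ := hj
      refine ⟨j, ?_⟩
      rintro ⟨v, hv⟩
      rw [hj] at hv
      exact (Fin.castSucc_lt_last v).ne hv
    · obtain ⟨z, rfl⟩ := exists_cast x hj
      rw [algSum_inj _ _ (Fin.castSucc_injective N)]
      exact o.sign_zero z (Or.inl fun h' => hx ((Fin.castSucc_injective N).comp h'))

/-- orientation of the stacked complex -/
noncomputable def stackOr :
    CoherentOrientation n (stackCx K _ (img_max K z0 hz0 hK) hF) where
  sign := stackSign o.sign z0
  sign_perm := by
    intro x σ
    unfold stackSign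
    rw [algSum_perm _ _ o.sign_perm, orW_perm]
    ring
  sign_unit := by
    intro x hx h
    by_cases hj : ∃ j, x j = Fin.last N
    · rw [mem_stack_last K z0 hz0 hF hK x hx hj] at h
      rw [stackSign_c K o z0 x hj]
      rcases orW_unit _ (coneW_inj z0 hz0) x hx h with h1 | h1 <;>
      rcases o.sign_unit z0 hz0 hF with h2 | h2 <;> simp [h1, h2]
    · obtain ⟨z, rfl⟩ := exists_cast x hj
      rw [mem_stack_cast K z0 hz0 hF hK] at h
      rw [stackSign_b K o z0 hz0 z hx.of_comp h.2]
      exact o.sign_unit z hx.of_comp h.1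
  sign_zero := stack_zero K o z0 hz0 hF hK
  coherent := by
    rintro x y ⟨i, hi, hij⟩ hsx hsy
    have hx : Function.Injective x := by
      by_contra h; exact hsx (stack_zero K o z0 hz0 hF hK x (Or.inl h))
    have hy : Function.Injective y := by
      by_contra h; exact hsy (stack_zero K o z0 hz0 hF hK y (Or.inl h))
    have hfx : Finset.image x Finset.univ ∈ (stackCx K _ (img_max K z0 hz0 hK) hF).faces := by
      by_contra h; exact hsx (stack_zero K o z0 hz0 hF hK x (Or.inr h))
    have hfy : Finset.image y Finset.univ ∈ (stackCx K _ (img_max K z0 hz0 hK) hF).faces := by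
      by_contra h; exact hsy (stack_zero K o z0 hz0 hF hK y (Or.inr h))
    by_cases hjx : ∃ j, x j = Fin.last N
    · have hrx := (mem_stack_last K z0 hz0 hF hK x hx hjx).mp hfx
      by_cases hjy : ∃ j, y j = Fin.last N
      · have hry := (mem_stack_last K z0 hz0 hF hK y hy hjy).mp hfy
        rw [stackSign_c K o z0 x hjx, stackSign_c K o z0 y hjy,
          orW_coh _ (coneW_inj z0 hz0) x y hx hy hrx hry i hi hij]
        ring
      · obtain ⟨z, rfl⟩ := exists_cast y hjy
        rw [mem_stack_cast K z0 hz0 hF hK] at hfy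
        exact mixed_coh K o z0 hz0 hF x z hx hy.of_comp hjx hrx hfy.1 hfy.2 i hij
    · obtain ⟨z, rfl⟩ := exists_cast x hjx
      rw [mem_stack_cast K z0 hz0 hF hK] at hfx
      by_cases hjy : ∃ j, y j = Fin.last N
      · have hry := (mem_stack_last K z0 hz0 hF hK y hy hjy).mp hfy
        have := mixed_coh K o z0 hz0 hF y z hy hx.of_comp hjy hry hfx.1 hfx.2 i
          (fun j h => (hij j h).symm)
        linarith
      · obtain ⟨z', rfl⟩ := exists_cast y hjy
        rw [mem_stack_cast K z0 hz0 hF hK] at hfy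
        rw [stackSign_b K o z0 hz0 z hx.of_comp hfx.2] at hsx ⊢
        rw [stackSign_b K o z0 hz0 z' hy.of_comp hfy.2] at hsy ⊢
        exact o.coherent z z' ⟨i, fun h => hi (by simp [h]),
          fun j hj => Fin.castSucc_injective N (hij j hj)⟩ hsx hsy

end StackOr

/-- a sphere with a map of given degree -/
structure Good (n N : ℕ) (k : ℤ) (K : AbsCx (Fin N)) (o : CoherentOrientation n K)
    (f : Fin N → Fin (n+2)) : Prop where
  vert : K.vertexSet = Set.univ
  sph : K.IsSphereTriangulation n
  card_le : ∀ s ∈ K.faces, s.card ≤ n + 1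
  deg : ∀ y, algSum o.sign f y = k * orW id y

theorem stack_step {n N : ℕ} (hn : 1 ≤ n) {k : ℤ} {K : AbsCx (Fin N)}
    {o : CoherentOrientation n K} {f : Fin N → Fin (n+2)} (G : Good n N k K o f)
    (z0 : Fin (n+1) → Fin N) (hz0 : Function.Injective z0)
    (hF : Finset.image z0 Finset.univ ∈ K.faces) (l : Fin (n+2)) :
    ∃ (K' : AbsCx (Fin (N+1))) (o' : CoherentOrientation n K'),
      Good n (N+1) (k - o.sign z0 * dsgn (Fin.cons l (f ∘ z0) : Fin (n+2) → Fin (n+2))) K' o'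
        (Fin.snoc (α := fun _ => Fin (n+2)) f l) ∧
      (∀ i, Finset.image (Function.update (Fin.castSucc ∘ z0) i (Fin.last N)) Finset.univ ∈ K'.faces ∧
        o'.sign (Function.update (Fin.castSucc ∘ z0) i (Fin.last N)) = o.sign z0) ∧
      (∀ z : Fin (n+1) → Fin N, Finset.image z Finset.univ ∈ K.faces →
        Finset.image z Finset.univ ≠ Finset.image z0 Finset.univ →
        Finset.image (Fin.castSucc ∘ z) Finset.univ ∈ K'.faces) := by
  refine ⟨_, stackOr K o z0 hz0 hF G.card_le, ⟨?_, ?_, ?_, ?_⟩, ?_, ?_⟩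
  · apply stack_vertex _ _ _ _ _ G.vert
    rw [card_img z0 hz0]; omega
  · obtain ⟨e⟩ := G.sph
    obtain ⟨e'⟩ := stack_homeo K _ (img_max K z0 hz0 G.card_le) hF n (card_img z0 hz0)
    exact ⟨e'.trans e⟩
  · exact stack_card _ _ _ _ (card_img z0 hz0) G.card_le
  · intro y
    change algSum (fun x => algSum o.sign Fin.castSucc x - o.sign z0 * orW (coneW z0) x) _ y = _
    rw [algSum_sub, algSum_comp, algSum_orW]
    have e1 : (Fin.snoc (α := fun _ => Fin (n+2)) f l) ∘ Fin.castSucc = f := by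
      ext v; simp
    have e2 : (Fin.snoc (α := fun _ => Fin (n+2)) f l) ∘ coneW z0 = Fin.cons l (f ∘ z0) := by
      ext v
      refine Fin.cases ?_ (fun v => ?_) v <;> simp [coneW]
    rw [e1, e2, orW_dsgn, G.deg]
    ring
  · intro i
    set x := Function.update (Fin.castSucc ∘ z0) i (Fin.last N) with hxdef
    have xi : x i = Fin.last N := by simp [x]
    have xk : ∀ k, k ≠ i → x k = (z0 k).castSucc := fun k hk => by simp [x, hk]
    have hx : Function.Injective x := by
      intro p q hpq
      by_cases hp : p = i
      · by_cases hq : q = i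
        · rw [hp, hq]
        · rw [hp, xi, xk q hq] at hpq
          exact absurd hpq.symm (Fin.castSucc_lt_last _).ne
      · by_cases hq : q = i
        · rw [hq, xi, xk p hp] at hpq
          exact absurd hpq (Fin.castSucc_lt_last _).ne
        · rw [xk p hp, xk q hq] at hpq
          exact hz0 (Fin.castSucc_injective N hpq)
    have hr : ∀ j, x j ∈ Set.range (coneW z0) := by
      intro j
      by_cases hj : j = i
      · rw [hj, xi]; exact mem_coneW_last z0
      · rw [xk j hj, mem_coneW_cast]; simp
    refine ⟨(mem_stack_last K z0 hz0 hF G.card_le x hx ⟨i, xi⟩).mpr hr, ?_⟩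
    change stackSign o.sign z0 x = _
    rw [stackSign_c K o z0 x ⟨i, xi⟩, orW_coh (coneW z0) (coneW_inj z0 hz0) (Fin.castSucc ∘ z0) x
      ((Fin.castSucc_injective N).comp hz0) hx (fun j => (mem_coneW_cast z0 _).mpr (by simp)) hr i
      (by rw [xi]; exact (Fin.castSucc_lt_last _).ne) (fun k hk => (xk k hk).symm),
      orW_cone_base z0 hz0]
    ring
  · intro z h1 h2
    exact (mem_stack_cast K z0 hz0 hF G.card_le z).mpr ⟨h1, h2⟩
/-- a sphere with a map of degree `k` and a facet on which exactly two labels agree -/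
def DegState (m N : ℕ) (k : ℤ) : Prop :=
  ∃ (K : AbsCx (Fin N)) (o : CoherentOrientation (m+2) K) (f : Fin N → Fin (m+2+2))
    (z : Fin (m+2+1) → Fin N), Good (m+2) N k K o f ∧ Function.Injective z ∧
    Finset.image z Finset.univ ∈ K.faces ∧ f (z 0) = f (z 1) ∧
    ∀ a b, a ≠ 0 → b ≠ 0 → f (z a) = f (z b) → a = b

theorem fin_zero_ne_two (m : ℕ) : (0 : Fin (m+2+1)) ≠ 2 := by
  intro h
  have h1 : 0 % (m+2+1) = 2 % (m+2+1) := congrArg Fin.val h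
  rw [Nat.mod_eq_of_lt (by omega), Nat.mod_eq_of_lt (by omega)] at h1
  omega

theorem fin_one_ne_two (m : ℕ) : (1 : Fin (m+2+1)) ≠ 2 := by
  intro h
  have h1 : 1 % (m+2+1) = 2 % (m+2+1) := congrArg Fin.val h
  rw [Nat.mod_eq_of_lt (by omega), Nat.mod_eq_of_lt (by omega)] at h1
  omega

theorem update_last_inj {m N : ℕ} (z : Fin (m+1) → Fin N) (hz : Function.Injective z) (i : Fin (m+1)) :
    Function.Injective (Function.update (Fin.castSucc ∘ z) i (Fin.last N)) := by
  intro p q hpq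
  have hne : ∀ v : Fin N, v.castSucc ≠ Fin.last N := fun v => (Fin.castSucc_lt_last v).ne
  by_cases hp : p = i <;> by_cases hq : q = i
  · rw [hp, hq]
  · rw [hp, Function.update_self, Function.update_of_ne hq] at hpq
    exact absurd hpq.symm (hne _)
  · rw [hq, Function.update_self, Function.update_of_ne hp] at hpq
    exact absurd hpq (hne _)
  · simp [hp, hq] at hpq
    exact hz hpq

theorem snoc_update {m N L : ℕ} (f : Fin N → Fin L) (p : Fin L) (z : Fin (m+1) → Fin N)
    (i : Fin (m+1)) :
    (Fin.snoc (α := fun _ => Fin L) f p) ∘ (Function.update (Fin.castSucc ∘ z) i (Fin.last N))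
      = Function.update (f ∘ z) i p := by
  ext j
  by_cases hj : j = i
  · subst hj; simp
  · simp [hj]

/-- the standard orientation -/
def stdOr (n : ℕ) : CoherentOrientation n (stdSphere n) where
  sign := orW id
  sign_perm := fun x σ => orW_perm id x σ
  sign_unit := fun x hx _ => orW_unit_id x hx
  sign_zero := by
    intro x h
    rcases h with h | h
    · exact orW_zero_inj _ _ h
    · exfalso
      apply h
      refine ⟨by simp, ?_⟩
      intro he
      have h1 : (Finset.image x Finset.univ).card ≤ n + 1 := by
        simpa using Finset.card_image_le (s := Finset.univ) (f := x)
      rw [he] at h1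
      simp at h1
  coherent := by
    rintro x y ⟨i, hi, hij⟩ hx hy
    apply orW_coh_id x y _ _ i hi hij
    · by_contra h; exact hx (orW_zero_inj _ _ h)
    · by_contra h; exact hy (orW_zero_inj _ _ h)

theorem std_good (n : ℕ) : Good n (n+2) 1 (stdSphere n) (stdOr n) id where
  vert := by
    rw [Set.eq_univ_iff_forall]
    intro v
    refine ⟨by simp, ?_⟩
    intro h
    have := congrArg Finset.card h
    simp at this
  sph := std_sphere n
  card_le := by
    rintro s ⟨_, hs⟩
    obtain ⟨x, hx⟩ : ∃ x, x ∉ s := by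
      by_contra hc
      push Not at hc
      exact hs (Finset.eq_univ_iff_forall.mpr hc)
    have h1 := Finset.card_lt_univ_of_notMem hx
    simp at h1
    omega
  deg := by
    intro y
    have := algSum_inj (stdOr n).sign (id : Fin (n+2) → Fin (n+2)) Function.injective_id y
    rw [one_mul]
    exact this

theorem base_state (m : ℕ) : DegState m (m+2+3) 1 := by
  let z : Fin (m+2+1) → Fin (m+2+2) := Fin.castSucc
  have hz : Function.Injective z := Fin.castSucc_injective _
  have hF : Finset.image z Finset.univ ∈ (stdSphere (m+2)).faces := by
    refine ⟨by simp, fun h => ?_⟩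
    have := Finset.mem_univ (Fin.last (m+2+1))
    rw [← h] at this
    simp [z, (Fin.castSucc_lt_last _).ne] at this
  obtain ⟨K, o, G, h1, -⟩ := stack_step (by omega) (std_good (m+2)) z hz hF (z 0)
  rw [dsgn_zero, mul_zero, sub_zero] at G
  · have e := snoc_update (id : Fin (m+2+2) → Fin (m+2+2)) (z 0) z 1
    refine ⟨K, o, _, _, G, update_last_inj z hz 1, (h1 1).1, ?_, ?_⟩
    · have e0 := congrFun e 0
      have e1 := congrFun e 1
      simp only [Function.comp] at e0 e1
      rw [e0, e1]
      simp
    · intro a b ha hb hab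
      have ea := congrFun e a
      have eb := congrFun e b
      simp only [Function.comp] at ea eb hab
      rw [ea, eb] at hab
      by_cases h : a = 1 <;> by_cases h' : b = 1
      · rw [h, h']
      · simp [h, h'] at hab
        exact absurd (hz hab).symm hb
      · simp [h, h'] at hab
        exact absurd (hz hab) ha
      · simp [h, h'] at hab
        exact hz hab
  · rw [Fin.cons_injective_iff]
    rintro ⟨h, _⟩
    exact h ⟨0, rfl⟩

theorem step_state (m N : ℕ) (k : ℤ) (h : DegState m N k) : DegState m (N+2) (k+1) := by
  obtain ⟨K, o, f, z, G, hz, hF, h01, hinj⟩ := h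
  set u := f ∘ z with hu
  obtain ⟨p, hp, q, hq, hpq⟩ : ∃ p, (∀ j, u j ≠ p) ∧ ∃ q, (∀ j, u j ≠ q) ∧ p ≠ q := by
    have hcard : (Finset.image u Finset.univ).card ≤ m + 2 := by
      have : Finset.image u Finset.univ ⊆ Finset.image u (Finset.univ.erase 0) := by
        intro v hv
        simp only [Finset.mem_image, Finset.mem_univ, true_and] at hv
        obtain ⟨j, rfl⟩ := hv
        by_cases hj : j = 0
        · subst hj
          exact Finset.mem_image.mpr ⟨1, by simp, h01.symm⟩
        · exact Finset.mem_image.mpr ⟨j, by simp [hj], rfl⟩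
      refine (Finset.card_le_card this).trans (Finset.card_image_le.trans ?_)
      simp
    have h2 : 1 < (Finset.image u Finset.univ)ᶜ.card := by
      rw [Finset.card_compl, Fintype.card_fin]
      omega
    obtain ⟨p, hp, q, hq, hpq⟩ := Finset.one_lt_card.mp h2
    simp only [Finset.mem_compl, Finset.mem_image, Finset.mem_univ, true_and, not_exists] at hp hq
    exact ⟨p, hp, q, hq, hpq⟩
  obtain ⟨K1, o1, G1, h1, -⟩ := stack_step (by omega) G z hz hF p
  rw [dsgn_zero, mul_zero, sub_zero] at G1
  swap
  · rw [Fin.cons_injective_iff]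
    rintro ⟨_, h⟩
    have := h (a₁ := 0) (a₂ := 1) h01
    simp at this
  have hv0 : Function.Injective (Function.update u 0 p) := by
    intro a b hab
    by_cases ha : a = 0 <;> by_cases hb : b = 0
    · rw [ha, hb]
    · simp only [ha, Function.update_self, Function.update_of_ne hb] at hab
      exact absurd hab.symm (hp b)
    · simp only [hb, Function.update_self, Function.update_of_ne ha] at hab
      exact absurd hab (hp a)
    · rw [Function.update_of_ne ha, Function.update_of_ne hb] at hab
      exact hinj a b ha hb hab
  have hc0 : Function.Injective (Fin.cons q (Function.update u 0 p) : Fin (m+2+2) → Fin (m+2+2)) := by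
    rw [Fin.cons_injective_iff]
    refine ⟨?_, hv0⟩
    rintro ⟨j, hj⟩
    by_cases h : j = 0
    · simp only [h, Function.update_self] at hj
      exact hpq hj
    · rw [Function.update_of_ne h] at hj
      exact hq j hj
  have hsw : (Fin.cons q (Function.update u 1 p) : Fin (m+2+2) → Fin (m+2+2)) =
      (Fin.cons q (Function.update u 0 p) : Fin (m+2+2) → Fin (m+2+2)) ∘
        Equiv.swap (Fin.succ 0) (Fin.succ 1) := by
    funext j
    refine Fin.cases ?_ (fun j => ?_) j
    · rw [Function.comp, Equiv.swap_apply_of_ne_of_ne]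
      · rfl
      · exact (Fin.succ_ne_zero _).symm
      · exact (Fin.succ_ne_zero _).symm
    · by_cases hj0 : j = 0
      · subst hj0
        rw [Function.comp, Equiv.swap_apply_left, Fin.cons_succ, Fin.cons_succ,
          Function.update_of_ne (by simp), Function.update_of_ne (by simp)]
        exact h01
      · by_cases hj1 : j = 1
        · subst hj1
          rw [Function.comp, Equiv.swap_apply_right, Fin.cons_succ, Fin.cons_succ]
          simp
        · rw [Function.comp, Equiv.swap_apply_of_ne_of_ne (fun h => hj0 (Fin.succ_injective _ h))
            (fun h => hj1 (Fin.succ_injective _ h)), Fin.cons_succ, Fin.cons_succ,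
            Function.update_of_ne hj1, Function.update_of_ne hj0]
  have hd1 := dsgn_swap (Fin.cons q (Function.update u 0 p) : Fin (m+2+2) → Fin (m+2+2))
    (Fin.succ 0) (Fin.succ 1) (fun h => by simpa using Fin.succ_injective _ h)
  rw [← hsw] at hd1
  obtain ⟨i, hi2, hi⟩ : ∃ i : Fin (m+2+1), i ≠ 2 ∧ o.sign z * dsgn (Fin.cons q (Function.update u i p) :
      Fin (m+2+2) → Fin (m+2+2)) = -1 := by
    have h02 := fin_zero_ne_two m
    have h12 := fin_one_ne_two m
    rcases o.sign_unit z hz hF with h | h <;> rcases dsgn_unit _ hc0 with h' | h'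
    · exact ⟨1, h12, by rw [hd1, h, h']; simp⟩
    · exact ⟨0, h02, by rw [h, h']; simp⟩
    · exact ⟨0, h02, by rw [h, h']; simp⟩
    · exact ⟨1, h12, by rw [hd1, h, h']; simp⟩
  obtain ⟨K2, o2, G2, -, h2⟩ := stack_step (by omega) G1 _ (update_last_inj z hz i) (h1 i).1 q
  rw [(h1 i).2, snoc_update f p z i, ← hu, hi, sub_neg_eq_add] at G2
  have hne : Finset.image (Function.update (Fin.castSucc ∘ z) 2 (Fin.last N)) Finset.univ ≠
      Finset.image (Function.update (Fin.castSucc ∘ z) i (Fin.last N)) Finset.univ := by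
    intro he
    have hm : (z i).castSucc ∈
        Finset.image (Function.update (Fin.castSucc ∘ z) 2 (Fin.last N)) Finset.univ :=
      Finset.mem_image.mpr ⟨i, by simp, by rw [Function.update_of_ne hi2]; rfl⟩
    rw [he] at hm
    obtain ⟨j, -, hj⟩ := Finset.mem_image.mp hm
    by_cases h : j = i
    · rw [h, Function.update_self] at hj
      exact (Fin.castSucc_lt_last _).ne hj.symm
    · rw [Function.update_of_ne h] at hj
      exact h (hz (Fin.castSucc_injective _ hj))
  have e : ∀ j, (Fin.snoc (α := fun _ => Fin (m+2+2)) (Fin.snoc (α := fun _ => Fin (m+2+2)) f p) q)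
      ((Fin.castSucc ∘ (Function.update (Fin.castSucc ∘ z) 2 (Fin.last N))) j)
      = Function.update u 2 p j := by
    intro j
    rw [Function.comp, Fin.snoc_castSucc, hu, ← snoc_update f p z 2]
    rfl
  have h20 := fin_zero_ne_two m
  have h21 := fin_one_ne_two m
  refine ⟨K2, o2, _, Fin.castSucc ∘ (Function.update (Fin.castSucc ∘ z) 2 (Fin.last N)), G2,
    (Fin.castSucc_injective _).comp (update_last_inj z hz 2), h2 _ (h1 2).1 hne, ?_, ?_⟩
  · rw [e, e, Function.update_of_ne h20, Function.update_of_ne h21]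
    exact h01
  · intro a b ha hb hab
    rw [e, e] at hab
    by_cases ha2 : a = 2 <;> by_cases hb2 : b = 2
    · rw [ha2, hb2]
    · simp only [ha2, Function.update_self, Function.update_of_ne hb2] at hab
      exact absurd hab.symm (hp b)
    · simp only [hb2, Function.update_self, Function.update_of_ne ha2] at hab
      exact absurd hab (hp a)
    · rw [Function.update_of_ne ha2, Function.update_of_ne hb2] at hab
      exact hinj a b ha hb hab

theorem all_states (m t : ℕ) : DegState m (m+2+3+2*t) (1+t) := by
  induction t with
  | zero => simpa using base_state m
  | succ t ih =>
    have := step_state _ _ _ ih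
    have e : ((1 : ℤ) + ((t+1 : ℕ) : ℤ)) = 1 + t + 1 := by push_cast; ring
    rw [e]
    exact this

/-- the opposite orientation -/
def negOr {V : Type*} [DecidableEq V] {n : ℕ} {K : AbsCx V} (o : CoherentOrientation n K) :
    CoherentOrientation n K where
  sign := fun x => - o.sign x
  sign_perm := fun x σ => by rw [o.sign_perm]; ring
  sign_unit := fun x hx h => by
    rcases o.sign_unit x hx h with h | h <;> simp [h]
  sign_zero := fun x h => by rw [o.sign_zero x h]; rfl
  coherent := fun x y h hx hy => by
    rw [o.coherent x y h (by simpa using hx) (by simpa using hy)]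

/-- For every nonzero `d` there is a triangulated `n`-sphere with `6|d| + n + 3`
vertices admitting a simplicial map of degree `3d + sign d` to `S^n_{n+2}`. -/
theorem stmt9 (d : ℤ) (hd : d ≠ 0) (n : ℕ) (hn : 2 ≤ n) :
    ∃ K : AbsCx (Fin (6 * d.natAbs + n + 3)),
      K.vertexSet = Set.univ ∧ K.IsSphereTriangulation n ∧
      ∃ (oK : CoherentOrientation n K) (oL : CoherentOrientation n (stdSphere n))
        (f : Fin (6 * d.natAbs + n + 3) → Fin (n + 2)),
        K.IsSimplicialMap (stdSphere n) f ∧ HasDegree oK oL f (3 * d + Int.sign d) := by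
  obtain ⟨m, rfl⟩ : ∃ m, n = m + 2 := ⟨n - 2, by omega⟩
  have hS := all_states m (3 * d.natAbs)
  rw [show m + 2 + 3 + 2 * (3 * d.natAbs) = 6 * d.natAbs + (m + 2) + 3 by ring] at hS
  obtain ⟨K, o, f, z, G, -⟩ := hS
  have hsimp : K.IsSimplicialMap (stdSphere (m+2)) f := by
    intro s hs
    refine ⟨(K.nonempty_of_mem hs).image f, ?_⟩
    intro he
    have h1 := (Finset.card_image_le (s := s) (f := f)).trans (G.card_le s hs)
    rw [he] at h1
    simp at h1
  refine ⟨K, G.vert, G.sph, ?_⟩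
  rcases lt_or_gt_of_ne hd with h | h
  · refine ⟨negOr o, stdOr _, f, hsimp, ?_⟩
    intro y hy
    have h1 : algSum (negOr o).sign f y = - algSum o.sign f y := by
      unfold algSum
      rw [← Finset.sum_neg_distrib]
      refine Finset.sum_congr rfl fun x _ => ?_
      split_ifs <;> simp [negOr]
    replace hy : orW id y = 1 := hy
    rw [h1, G.deg, hy, Int.sign_eq_neg_one_of_neg h]
    push_cast
    rw [abs_of_neg h]
    ring
  · refine ⟨o, stdOr _, f, hsimp, ?_⟩
    intro y hy
    replace hy : orW id y = 1 := hy
    rw [G.deg, hy, Int.sign_eq_one_of_pos h]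
    push_cast
    rw [abs_of_pos h]
    ring
end
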